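/- For every integer d ≥ 2 there exist constants C > 0 and c > 0 such that for every probability measure μ on ℝ with μ([−2d, 2d]) = 1 and with moments ∫ λ^n dμ(λ) = T_n(d) for all integers n ≥ 0, and for every real ε with 0 < ε ≤ 1, one has c·exp(−C·ε^{−d/2}·log(1/ε + 2)) ≤ μ((−∞, −2d + ε]) ≤ C·exp(−c·ε^{−d/2}). -/

import Mathlib

open scoped BigOperators

/-- Points of `ℤ^d`. -/
abbrev Vtx (d : ℕ) := Fin d → ℤ

/-- The `ℓ¹` distance on `ℤ^d`. -/
def dist1 {d : ℕ} (x y : Vtx d) : ℕ := ∑ i, (x i - y i).natAbs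

/-- `x : Fin (n+1) → ℤ^d` is a path of length `n` (nearest-neighbour steps). -/
def IsPath {d n : ℕ} (x : Fin (n + 1) → Vtx d) : Prop :=
  ∀ i : Fin n, dist1 (x i.succ) (x i.castSucc) = 1

/-- The transposition product `(x₀ x₁)∘(x₁ x₂)∘⋯∘(x_{n-1} x_n)`. -/
def transProd {d n : ℕ} (x : Fin (n + 1) → Vtx d) : Equiv.Perm (Vtx d) :=
  ((List.finRange n).map (fun i => Equiv.swap (x i.castSucc) (x i.succ))).prod

/-- The number of paths of length `n` in `ℤ^d`, starting at `x₀`, staying in `B`,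
with identity transposition product. -/
noncomputable def numPathsIn (d n : ℕ) (B : Set (Vtx d)) (x₀ : Vtx d) : ℕ :=
  Nat.card {x : Fin (n + 1) → Vtx d //
    IsPath x ∧ x 0 = x₀ ∧ (∀ i, x i ∈ B) ∧ transProd x = 1}

/-- `T n d`: the number of paths of length `n` in `ℤ^d` starting at the origin whose
transposition product is the identity. -/
noncomputable def T (n d : ℕ) : ℕ := numPathsIn d n Set.univ 0

open MeasureTheory

namespace Umpteen

variable {d : ℕ}

/-- The `2d` unit directions of `ℤ^d`. -/
abbrev Dir (d : ℕ) := Fin d × ℤˣ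

/-- The unit vector of a direction. -/
def Dir.vec (s : Dir d) : Vtx d := Pi.single s.1 (s.2 : ℤ)

/-- The opposite direction. -/
def Dir.opp (s : Dir d) : Dir d := (s.1, -s.2)

lemma Dir.vec_opp (s : Dir d) : s.opp.vec = -s.vec := by
  simp [Dir.vec, Dir.opp, Pi.single_neg]

lemma Dir.opp_opp (s : Dir d) : s.opp.opp = s := by
  simp [Dir.opp]

lemma Dir.vec_injective : Function.Injective (Dir.vec (d := d)) := by
  rintro ⟨i, u⟩ ⟨j, v⟩ h
  have hi := congrFun h i
  by_cases hij : i = j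
  · subst hij
    simpa [Dir.vec, Units.ext_iff] using hi
  · simp [Dir.vec, hij] at hi

lemma Dir.vec_ne_zero (s : Dir d) : s.vec ≠ 0 := by
  intro h
  have := congrFun h s.1
  simp [Dir.vec] at this

lemma Dir.card_eq : Fintype.card (Dir d) = 2 * d := by
  simp [Fintype.card_prod, mul_comm]

lemma dist1_eq_one_iff (x y : Vtx d) : dist1 y x = 1 ↔ ∃ s : Dir d, y = x + s.vec := by
  constructor
  · intro h
    unfold dist1 at h
    obtain ⟨i, -, hi⟩ : ∃ i ∈ Finset.univ, (y i - x i).natAbs ≠ 0 := by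
      by_contra! hc
      rw [Finset.sum_eq_zero hc] at h
      exact zero_ne_one h
    rw [← Finset.add_sum_erase _ _ (Finset.mem_univ i)] at h
    have h1 : (y i - x i).natAbs = 1 := by omega
    have h0 : ∑ j ∈ Finset.univ.erase i, (y j - x j).natAbs = 0 := by omega
    rw [Finset.sum_eq_zero_iff] at h0
    refine ⟨(i, (Int.isUnit_iff_natAbs_eq.2 h1).unit), ?_⟩
    ext j
    by_cases hj : j = i
    · subst hj
      simp [Dir.vec]
    · have := h0 j (by simp [hj])
      simp only [Dir.vec, Pi.add_apply, Pi.single_eq_of_ne hj]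
      omega
  · rintro ⟨⟨i, u⟩, rfl⟩
    unfold dist1
    rw [Finset.sum_eq_single i]
    · simp [Dir.vec]
    · intro j _ hj
      simp [Dir.vec, hj]
    · simp

open Classical in
/-- The number of paths of length `n` starting at `x` with transposition product `σ`. -/
noncomputable def cnt : ℕ → Vtx d → Equiv.Perm (Vtx d) → ℕ
  | 0, _, σ => if σ = 1 then 1 else 0
  | n + 1, x, σ => ∑ s : Dir d, cnt n (x + s.vec) (Equiv.swap x (x + s.vec) * σ)

lemma transProd_cons {n : ℕ} (x : Vtx d) (p : Fin (n + 1) → Vtx d) :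
    transProd (Fin.cons x p : Fin (n + 2) → Vtx d) = Equiv.swap x (p 0) * transProd p := by
  unfold transProd
  rw [List.finRange_succ, List.map_cons, List.prod_cons, List.map_map]
  congr 1

lemma isPath_cons {n : ℕ} (x : Vtx d) (p : Fin (n + 1) → Vtx d) :
    IsPath (Fin.cons x p : Fin (n + 2) → Vtx d) ↔ dist1 (p 0) x = 1 ∧ IsPath p := by
  unfold IsPath
  rw [Fin.forall_fin_succ]
  rfl

/-- Paths of length `n` starting at `x` with transposition product `σ`. -/
abbrev PathsTo (n : ℕ) (x : Vtx d) (σ : Equiv.Perm (Vtx d)) :=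
  {p : Fin (n + 1) → Vtx d // IsPath p ∧ p 0 = x ∧ (∀ i, p i ∈ Set.univ) ∧ transProd p = σ}

/-- Prepend a step to a path. -/
def consPath (n : ℕ) (x : Vtx d) (σ : Equiv.Perm (Vtx d))
    (q : Σ s : Dir d, PathsTo n (x + s.vec) (Equiv.swap x (x + s.vec) * σ)) :
    PathsTo (n + 1) x σ :=
  ⟨Fin.cons x q.2.1, by
    obtain ⟨s, p, hp, h0, -, hσ⟩ := q
    refine ⟨(isPath_cons x p).2 ⟨(dist1_eq_one_iff _ _).2 ⟨s, h0⟩, hp⟩, rfl, by simp, ?_⟩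
    change transProd (Fin.cons x p : Fin (n + 2) → Vtx d) = σ
    rw [transProd_cons, h0, hσ, ← mul_assoc, Equiv.swap_mul_self, one_mul]⟩

lemma consPath_bijective (n : ℕ) (x : Vtx d) (σ : Equiv.Perm (Vtx d)) :
    Function.Bijective (consPath n x σ) := by
  constructor
  · rintro ⟨s, p, hp⟩ ⟨s', p', hp'⟩ h
    have h1 : p = p' := by
      have : (Fin.cons x p : Fin (n + 2) → Vtx d) = Fin.cons x p' := congrArg Subtype.val h
      exact (Fin.cons_injective2 this).2
    subst h1
    have h2 : s = s' := by
      have := hp.2.1.symm.trans hp'.2.1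
      exact Dir.vec_injective (add_left_cancel this)
    subst h2
    rfl
  · rintro ⟨p, hp, h0, -, hσ⟩
    obtain ⟨q, rfl⟩ : ∃ q : Fin (n + 1) → Vtx d, p = Fin.cons x q :=
      ⟨Fin.tail p, by rw [← h0, Fin.cons_self_tail]⟩
    rw [isPath_cons] at hp
    obtain ⟨s, hs⟩ := (dist1_eq_one_iff _ _).1 hp.1
    refine ⟨⟨s, q, hp.2, hs, by simp, ?_⟩, rfl⟩
    rw [← hσ, transProd_cons, hs, ← mul_assoc, Equiv.swap_mul_self, one_mul]

lemma card_pathsTo (n : ℕ) : ∀ (x : Vtx d) (σ : Equiv.Perm (Vtx d)),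
    Finite (PathsTo n x σ) ∧ Nat.card (PathsTo n x σ) = cnt n x σ := by
  induction n with
  | zero =>
    intro x σ
    have hsub : Subsingleton (PathsTo 0 x σ) := by
      constructor
      rintro ⟨p, hp⟩ ⟨q, hq⟩
      ext i : 2
      rw [Fin.fin_one_eq_zero i]
      exact hp.2.1.trans hq.2.1.symm
    refine ⟨inferInstance, ?_⟩
    by_cases hσ : σ = 1
    · subst hσ
      have : Nonempty (PathsTo 0 x 1) :=
        ⟨⟨fun _ => x, fun i => i.elim0, rfl, by simp, by simp [transProd]⟩⟩
      simp [cnt]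
    · have : IsEmpty (PathsTo 0 x σ) := by
        constructor
        rintro ⟨p, hp⟩
        apply hσ
        rw [← hp.2.2.2]
        simp [transProd]
      simp [cnt, hσ]
  | succ n ih =>
    intro x σ
    have hf : ∀ s : Dir d, Finite (PathsTo n (x + s.vec) (Equiv.swap x (x + s.vec) * σ)) :=
      fun s => (ih _ _).1
    have e := Equiv.ofBijective _ (consPath_bijective n x σ)
    refine ⟨Finite.of_equiv _ e, ?_⟩
    rw [← Nat.card_congr e, Nat.card_sigma]
    simp only [cnt, (ih _ _).2]

lemma T_eq_cnt (n d : ℕ) : T n d = cnt n (0 : Vtx d) 1 :=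
  (card_pathsTo n 0 1).2

lemma cnt_parity (n : ℕ) : ∀ (x : Vtx d) (σ : Equiv.Perm (Vtx d)), cnt n x σ ≠ 0 →
    Even ((∑ i, (σ⁻¹ x) i) - (∑ i, x i) - n) := by
  induction n with
  | zero =>
    intro x σ h
    have : σ = 1 := by
      by_contra hσ
      simp [cnt, hσ] at h
    simp [this]
  | succ n ih =>
    intro x σ h
    obtain ⟨s, -, hs⟩ := Finset.exists_ne_zero_of_sum_ne_zero h
    have h1 := ih _ _ hs
    rw [mul_inv_rev, Equiv.swap_inv, Equiv.Perm.mul_apply, Equiv.swap_apply_right] at h1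
    have h2 : ∑ i, (x + s.vec) i = ∑ i, x i + (s.2 : ℤ) := by
      simp [Finset.sum_add_distrib, Dir.vec]
    rw [h2] at h1
    rcases Int.units_eq_one_or s.2 with h3 | h3 <;> rw [h3] at h1 <;> push_cast at h1 ⊢ <;>
      rw [Int.even_iff] at * <;> omega

lemma T_odd {n : ℕ} (hn : Odd n) : T n d = 0 := by
  by_contra h
  rw [T_eq_cnt] at h
  have := cnt_parity n _ _ h
  simp at this
  exact Nat.not_even_iff_odd.2 hn this

open Classical in
/-- Right translation of a set of permutations by the transposition of a step. -/
noncomputable def act (A : Finset (Equiv.Perm (Vtx d))) (y : Vtx d) (s : Dir d) :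
    Finset (Equiv.Perm (Vtx d)) :=
  A.image (· * Equiv.swap y (y + s.vec))

lemma mem_act {A : Finset (Equiv.Perm (Vtx d))} {y : Vtx d} {s : Dir d}
    {σ : Equiv.Perm (Vtx d)} :
    σ ∈ act A y s ↔ ∃ σ' ∈ A, σ' * Equiv.swap y (y + s.vec) = σ := by
  classical
  exact Finset.mem_image

lemma act_act_opp (A : Finset (Equiv.Perm (Vtx d))) (y : Vtx d) (s : Dir d) :
    act (act A y s) (y + s.vec) s.opp = A := by
  ext σ
  simp only [mem_act]
  have h : Equiv.swap (y + s.vec) (y + s.vec + s.opp.vec) = Equiv.swap y (y + s.vec) := by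
    rw [Dir.vec_opp, add_neg_cancel_right, Equiv.swap_comm]
  rw [h]
  constructor
  · rintro ⟨_, ⟨σ', hσ', rfl⟩, rfl⟩
    rwa [Equiv.mul_swap_mul_self]
  · intro hσ
    exact ⟨_, ⟨σ, hσ, rfl⟩, by rw [Equiv.mul_swap_mul_self]⟩

/-- The permutations in `A` are the identity outside of `W`. -/
def FixesOff (A : Finset (Equiv.Perm (Vtx d))) (W : Finset (Vtx d)) : Prop :=
  ∀ σ ∈ A, ∀ z ∉ W, σ z = z

lemma FixesOff.act {A : Finset (Equiv.Perm (Vtx d))} {W : Finset (Vtx d)} (h : FixesOff A W)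
    {y : Vtx d} (hy : y ∈ W) (s : Dir d) : FixesOff (act A y s) (insert (y + s.vec) W) := by
  intro σ hσ z hz
  obtain ⟨σ', hσ', rfl⟩ := mem_act.1 hσ
  simp only [Finset.mem_insert, not_or] at hz
  rw [Equiv.Perm.mul_apply, Equiv.swap_apply_of_ne_of_ne (by rintro rfl; exact hz.2 hy) hz.1,
    h σ' hσ' z hz.2]

/-- The number of ways to reach `τ` from a permutation in `A` with a path of length `n`
starting at `y`. -/
noncomputable def total (n : ℕ) (y : Vtx d) (A : Finset (Equiv.Perm (Vtx d)))
    (τ : Equiv.Perm (Vtx d)) : ℝ :=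
  ∑ σ ∈ A, (cnt n y (σ⁻¹ * τ) : ℝ)

lemma total_succ (n : ℕ) (y : Vtx d) (A : Finset (Equiv.Perm (Vtx d)))
    (τ : Equiv.Perm (Vtx d)) :
    total (n + 1) y A τ = ∑ s : Dir d, total n (y + s.vec) (act A y s) τ := by
  classical
  unfold total
  simp only [cnt, Nat.cast_sum]
  rw [Finset.sum_comm]
  refine Finset.sum_congr rfl fun s _ => ?_
  unfold act
  rw [Finset.sum_image (fun a _ b _ h => mul_right_cancel h)]
  simp [mul_assoc]

lemma total_le (n : ℕ) : ∀ (y : Vtx d) (A : Finset (Equiv.Perm (Vtx d)))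
    (τ : Equiv.Perm (Vtx d)), total n y A τ ≤ (2 * d : ℝ) ^ n := by
  induction n with
  | zero =>
    intro y A τ
    classical
    unfold total
    simp only [cnt, pow_zero, inv_mul_eq_one]
    rw [← Nat.cast_sum, Finset.sum_ite_eq']
    split_ifs <;> norm_num
  | succ n ih =>
    intro y A τ
    rw [total_succ]
    refine (Finset.sum_le_sum fun s _ => ih _ _ _).trans ?_
    rw [Finset.sum_const, Finset.card_univ, Dir.card_eq, nsmul_eq_mul, pow_succ']
    push_cast
    rfl

/-- The number of walks of length `n` from `y` that keep the set of visited sites,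
including `W`, of cardinality less than `K`. -/
def confined (K : ℕ) : ℕ → Vtx d → Finset (Vtx d) → ℝ
  | 0, _, W => if W.card < K then 1 else 0
  | n + 1, y, W => ∑ s : Dir d, confined K n (y + s.vec) (insert (y + s.vec) W)

lemma confined_nonneg (K n : ℕ) : ∀ (y : Vtx d) (W : Finset (Vtx d)),
    0 ≤ confined K n y W := by
  induction n with
  | zero => intro y W; unfold confined; split_ifs <;> norm_num
  | succ n ih => intro y W; exact Finset.sum_nonneg fun s _ => ih _ _

lemma confined_eq_of_small (K n : ℕ) : ∀ (y : Vtx d) (W : Finset (Vtx d)), W.card + n < K →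
    confined K n y W = (2 * d : ℝ) ^ n := by
  induction n with
  | zero => intro y W h; simpa [confined] using h
  | succ n ih =>
    intro y W h
    unfold confined
    have h1 : ∀ s ∈ (Finset.univ : Finset (Dir d)),
        confined K n (y + s.vec) (insert (y + s.vec) W) = (2 * d : ℝ) ^ n := by
      intro s _
      apply ih
      have := Finset.card_insert_le (y + s.vec) W
      omega
    rw [Finset.sum_congr rfl h1, Finset.sum_const, Finset.card_univ, Dir.card_eq, nsmul_eq_mul,
      pow_succ']
    push_cast
    rfl

lemma sum_le_of_merge {Ω : Type*} [Fintype Ω] (f g : Ω → ℝ) (c : ℝ) (v w : Ω)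
    (hvw : v ≠ w) (h : ∀ u, f u ≤ c + g u) (hm : f v + f w ≤ c + g w) (hg : 0 ≤ g v) :
    ∑ u, f u ≤ ((Fintype.card Ω : ℝ) - 1) * c + ∑ u, g u := by
  classical
  have key : ∀ φ : Ω → ℝ, ∑ u, φ u = φ v + φ w + ∑ u ∈ (Finset.univ.erase v).erase w, φ u := by
    intro φ
    rw [← Finset.add_sum_erase _ φ (Finset.mem_univ v),
      ← Finset.add_sum_erase _ φ (Finset.mem_erase.2 ⟨hvw.symm, Finset.mem_univ w⟩), add_assoc]
  have h1 := key (fun _ => (1 : ℝ))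
  simp only [Finset.sum_const, Finset.card_univ, nsmul_eq_mul, mul_one] at h1
  rw [key f, key g]
  have h2 := Finset.sum_le_sum fun u (_ : u ∈ (Finset.univ.erase v).erase w) => h u
  rw [Finset.sum_add_distrib, Finset.sum_const, nsmul_eq_mul] at h2
  have h3 : ((Fintype.card Ω : ℝ) - 1) * c
      = c + (((Finset.univ.erase v).erase w).card : ℝ) * c := by
    rw [h1]; ring
  rw [h3]
  linarith

lemma exists_transverse (hd : 2 ≤ d) (a : Dir d) :
    ∃ b : Dir d, b.vec ≠ a.vec ∧ a.vec + b.vec ≠ 0 := by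
  have : Nontrivial (Fin d) := Fin.nontrivial_iff_two_le.2 hd
  obtain ⟨j, hj⟩ := exists_ne a.1
  refine ⟨(j, 1), fun h => ?_, fun h => ?_⟩
  · have := congrFun h j
    simp [Dir.vec, hj] at this
  · have := congrFun h j
    simp [Dir.vec, hj] at this

lemma disjoint_act_square {A : Finset (Equiv.Perm (Vtx d))} {W : Finset (Vtx d)}
    (hA : FixesOff A W) {y : Vtx d} {a b : Dir d} (ha : y + a.vec ∉ W)
    (hab : b.vec ≠ a.vec) (hab' : a.vec + b.vec ≠ 0) :
    Disjoint A (act (act (act (act A y a) (y + a.vec) b) (y + a.vec + b.vec) a.opp)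
      (y + a.vec + b.vec + a.opp.vec) b.opp) := by
  rw [Finset.disjoint_left]
  intro σ hσ hσ'
  simp only [mem_act] at hσ'
  obtain ⟨_, ⟨_, ⟨_, ⟨ρ, hρ, rfl⟩, rfl⟩, rfl⟩, rfl⟩ := hσ'
  have h1 := hA _ hσ _ ha
  have e1 : y + a.vec + b.vec + a.opp.vec = y + b.vec := by rw [Dir.vec_opp]; abel
  have e2 : y + b.vec + b.opp.vec = y := by rw [Dir.vec_opp]; abel
  have ha0 := a.vec_ne_zero
  have hb0 := b.vec_ne_zero
  rw [e1, e2] at h1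
  simp only [Equiv.Perm.mul_apply] at h1
  rw [Equiv.swap_apply_of_ne_of_ne (a := y + b.vec) (b := y) (by simpa using hab.symm)
      (by simpa using ha0),
    Equiv.swap_apply_of_ne_of_ne (a := y + a.vec + b.vec) (b := y + b.vec) (by simpa using hb0)
      (by simpa using hab.symm), Equiv.swap_apply_left,
    Equiv.swap_apply_of_ne_of_ne (by simpa [add_assoc] using hab') (by simpa using hb0)] at h1
  rw [← hA _ hρ _ ha] at h1
  have h2 := ρ.injective h1
  have h3 := hA _ hρ _ ha
  rw [h3] at h2
  exact hb0 (by simpa using h2)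

/-- The set obtained from `W` by adding the sites visited in four steps from `y`. -/
def visit (y : Vtx d) (W : Finset (Vtx d)) (w : Dir d × Dir d × Dir d × Dir d) :
    Finset (Vtx d) :=
  insert (y + w.1.vec + w.2.1.vec + w.2.2.1.vec + w.2.2.2.vec)
    (insert (y + w.1.vec + w.2.1.vec + w.2.2.1.vec)
      (insert (y + w.1.vec + w.2.1.vec) (insert (y + w.1.vec) W)))

lemma card_visit_le (y : Vtx d) (W : Finset (Vtx d)) (w : Dir d × Dir d × Dir d × Dir d) :
    (visit y W w).card ≤ W.card + 4 := by
  unfold visit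
  refine (Finset.card_insert_le _ _).trans ?_
  refine (Nat.add_le_add_right (Finset.card_insert_le _ _) 1).trans ?_
  refine (Nat.add_le_add_right (Nat.add_le_add_right (Finset.card_insert_le _ _) 1) 1).trans ?_
  refine (Nat.add_le_add_right (Nat.add_le_add_right (Nat.add_le_add_right
    (Finset.card_insert_le _ _) 1) 1) 1).trans ?_
  omega

/-- The translate of `A` by the transposition product of four steps from `y`. -/
noncomputable def act₄ (A : Finset (Equiv.Perm (Vtx d))) (y : Vtx d)
    (w : Dir d × Dir d × Dir d × Dir d) : Finset (Equiv.Perm (Vtx d)) :=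
  act (act (act (act A y w.1) (y + w.1.vec) w.2.1) (y + w.1.vec + w.2.1.vec) w.2.2.1)
    (y + w.1.vec + w.2.1.vec + w.2.2.1.vec) w.2.2.2

lemma FixesOff.act₄ {A : Finset (Equiv.Perm (Vtx d))} {W : Finset (Vtx d)} (h : FixesOff A W)
    {y : Vtx d} (hy : y ∈ W) (w : Dir d × Dir d × Dir d × Dir d) :
    FixesOff (act₄ A y w) (visit y W w) :=
  (((h.act hy _).act (Finset.mem_insert_self _ _) _).act (Finset.mem_insert_self _ _) _).act
    (Finset.mem_insert_self _ _) _

lemma total_le_confined (hd : 2 ≤ d) (K : ℕ) (β : ℝ) (hβ : 1 ≤ β)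
    (hβ' : β ^ 4 * ((2 * d : ℝ) ^ 4 - 1) ≤ (2 * d : ℝ) ^ 4) (n : ℕ) :
    ∀ (y : Vtx d) (W : Finset (Vtx d)) (A : Finset (Equiv.Perm (Vtx d)))
      (τ : Equiv.Perm (Vtx d)), y ∈ W → FixesOff A W →
      total n y A τ ≤ (2 * d : ℝ) ^ n * (β ^ (W.card + 3) / β ^ K) + confined K n y W := by
  have hβ0 : 0 < β := by linarith
  have hD : (0 : ℝ) ≤ 2 * d := by positivity
  induction n using Nat.strong_induction_on with
  | _ n ih =>
  intro y W A τ hy hA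
  rcases lt_or_ge n 4 with hn | hn
  · rcases le_or_gt K (W.card + 3) with hK | hK
    · have h1 : 1 ≤ β ^ (W.card + 3) / β ^ K := by
        rw [one_le_div (by positivity)]
        exact pow_le_pow_right₀ hβ hK
      have h2 := mul_le_mul_of_nonneg_left h1 (pow_nonneg hD n)
      have h3 := confined_nonneg K n y W
      have h4 := total_le n y A τ
      linarith
    · rw [confined_eq_of_small K n y W (by omega)]
      have h4 := total_le n y A τ
      have : 0 ≤ (2 * d : ℝ) ^ n * (β ^ (W.card + 3) / β ^ K) := by positivity
      linarith
  · obtain ⟨n, rfl⟩ := Nat.exists_eq_add_of_le' hn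
    by_cases hfresh : ∃ a : Dir d, y + a.vec ∉ W
    · obtain ⟨a, ha⟩ := hfresh
      obtain ⟨b, hab, hab'⟩ := exists_transverse hd a
      let f : Dir d × Dir d × Dir d × Dir d → ℝ := fun w =>
        total n (y + w.1.vec + w.2.1.vec + w.2.2.1.vec + w.2.2.2.vec) (act₄ A y w) τ
      let g : Dir d × Dir d × Dir d × Dir d → ℝ := fun w =>
        confined K n (y + w.1.vec + w.2.1.vec + w.2.2.1.vec + w.2.2.2.vec) (visit y W w)
      have hf : total (n + 4) y A τ = ∑ w, f w := by
        simp only [total_succ, Fintype.sum_prod_type]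
        rfl
      have hg : confined K (n + 4) y W = ∑ w, g w := by
        simp only [confined, Fintype.sum_prod_type]
        rfl
      have hcard : Fintype.card (Dir d × Dir d × Dir d × Dir d) = (2 * d) ^ 4 := by
        simp only [Fintype.card_prod (Dir d), Dir.card_eq]
        ring
      have hpow : ∀ w, (2 * d : ℝ) ^ n * (β ^ ((visit y W w).card + 3) / β ^ K)
          ≤ (2 * d : ℝ) ^ n * (β ^ (W.card + 4 + 3) / β ^ K) := by
        intro w
        have := card_visit_le y W w
        gcongr
      have hmerge := sum_le_of_merge f g ((2 * d : ℝ) ^ n * (β ^ (W.card + 4 + 3) / β ^ K))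
        (a, a.opp, a, a.opp) (a, b, a.opp, b.opp) (by
          intro h
          simp only [Prod.mk.injEq, true_and] at h
          exact hab' (by rw [← h.1, Dir.vec_opp, add_neg_cancel])) (by
          intro w
          have hw : f w ≤ (2 * d : ℝ) ^ n * (β ^ ((visit y W w).card + 3) / β ^ K) + g w :=
            ih n (by omega) _ _ _ τ (Finset.mem_insert_self _ _) (hA.act₄ hy w)
          linarith [hpow w]) (by
          have e0 : y + a.vec + a.opp.vec + a.vec + a.opp.vec = y := by
            rw [Dir.vec_opp]; abel
          have e1 : y + a.vec + b.vec + a.opp.vec + b.opp.vec = y := by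
            rw [Dir.vec_opp, Dir.vec_opp]; abel
          have eA : act₄ A y (a, a.opp, a, a.opp) = A := by
            unfold act₄
            simp only [act_act_opp]
          have hdisj : Disjoint A (act₄ A y (a, b, a.opp, b.opp)) :=
            disjoint_act_square hA ha hab hab'
          classical
          have hsub : W ⊆ visit y W (a, b, a.opp, b.opp) := fun z hz => by simp [visit, hz]
          have hfix : FixesOff (A ∪ act₄ A y (a, b, a.opp, b.opp))
              (visit y W (a, b, a.opp, b.opp)) := by
            intro σ hσ z hz
            rcases Finset.mem_union.1 hσ with h | h
            · exact hA σ h z fun hz' => hz (hsub hz')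
            · exact hA.act₄ hy _ σ h z hz
          have hU := ih n (by omega) y (visit y W (a, b, a.opp, b.opp)) _ τ (hsub hy) hfix
          have hsum : total n y (A ∪ act₄ A y (a, b, a.opp, b.opp)) τ
              = total n y A τ + total n y (act₄ A y (a, b, a.opp, b.opp)) τ :=
            Finset.sum_union hdisj
          simp only [f, g]
          rw [e0, e1, eA, ← hsum]
          linarith [hpow (a, b, a.opp, b.opp)])
        (confined_nonneg _ _ _ _)
      rw [hf, hg]
      refine hmerge.trans ?_
      rw [hcard]
      have : (((2 * d) ^ 4 : ℕ) - 1 : ℝ) * ((2 * d : ℝ) ^ n * (β ^ (W.card + 4 + 3) / β ^ K))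
          = (β ^ 4 * ((2 * d : ℝ) ^ 4 - 1))
            * ((2 * d : ℝ) ^ n * (β ^ (W.card + 3) / β ^ K)) := by
        push_cast
        ring
      rw [this]
      have := mul_le_mul_of_nonneg_right hβ'
        (show 0 ≤ (2 * d : ℝ) ^ n * (β ^ (W.card + 3) / β ^ K) by positivity)
      rw [← mul_assoc ((2 * d : ℝ) ^ 4), ← pow_add, add_comm 4 n] at this
      linarith
    · push Not at hfresh
      rw [total_succ]
      have h1 : ∀ s ∈ (Finset.univ : Finset (Dir d)), total (n + 3) (y + s.vec) (act A y s) τ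
          ≤ (2 * d : ℝ) ^ (n + 3) * (β ^ (W.card + 3) / β ^ K)
            + confined K (n + 3) (y + s.vec) (insert (y + s.vec) W) := by
        intro s _
        have := ih (n + 3) (by omega) (y + s.vec) _ _ τ (Finset.mem_insert_self _ _)
          (hA.act hy s)
        rwa [Finset.insert_eq_of_mem (hfresh s)] at this ⊢
      refine (Finset.sum_le_sum h1).trans ?_
      rw [Finset.sum_add_distrib, Finset.sum_const, Finset.card_univ, Dir.card_eq, nsmul_eq_mul]
      apply le_of_eq
      rw [show n + 4 = n + 3 + 1 by rfl, pow_succ (2 * d : ℝ) (n + 3)]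
      simp only [confined]
      push_cast
      ring

/-- The sum of `f` over the endpoints of all walks of length `n` from `y`. -/
def walk {R : Type*} [AddCommMonoid R] : ℕ → (Vtx d → R) → Vtx d → R
  | 0, f, y => f y
  | n + 1, f, y => ∑ s : Dir d, walk n f (y + s.vec)

lemma walk_mono (n : ℕ) {f g : Vtx d → ℝ} (h : ∀ x, f x ≤ g x) (y : Vtx d) :
    walk n f y ≤ walk n g y := by
  induction n generalizing y with
  | zero => exact h y
  | succ n ih => exact Finset.sum_le_sum fun s _ => ih _

lemma walk_sum_mul {R ι : Type*} [CommSemiring R] (n : ℕ) (S : Finset ι) (c : ι → R)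
    (f : ι → Vtx d → R) (y : Vtx d) :
    walk n (fun x => ∑ a ∈ S, c a * f a x) y = ∑ a ∈ S, c a * walk n (f a) y := by
  induction n generalizing y with
  | zero => rfl
  | succ n ih =>
    simp only [walk, ih, Finset.mul_sum]
    rw [Finset.sum_comm]

lemma walk_const (n : ℕ) (c : ℝ) (y : Vtx d) : walk n (fun _ => c) y = (2 * d : ℝ) ^ n * c := by
  induction n generalizing y with
  | zero => simp [walk]
  | succ n ih =>
    simp only [walk, ih, Finset.sum_const, Finset.card_univ, Dir.card_eq, nsmul_eq_mul, pow_succ']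
    push_cast
    ring

lemma walk_add_mul (n : ℕ) (a b : ℝ) (f g : Vtx d → ℝ) (y : Vtx d) :
    walk n (fun x => a * f x + b * g x) y = a * walk n f y + b * walk n g y := by
  induction n generalizing y with
  | zero => rfl
  | succ n ih => simp only [walk, ih, Finset.sum_add_distrib, Finset.mul_sum]

lemma walk_re (n : ℕ) (f : Vtx d → ℂ) (y : Vtx d) :
    walk n (fun x => (f x).re) y = (walk n f y).re := by
  induction n generalizing y with
  | zero => rfl
  | succ n ih => simp only [walk, ih, Complex.re_sum]

lemma walk_eigen {R : Type*} [CommSemiring R] (n : ℕ) (f : Vtx d → R) (l : R)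
    (h : ∀ y, ∑ s : Dir d, f (y + s.vec) = l * f y) (y : Vtx d) :
    walk n f y = l ^ n * f y := by
  induction n generalizing y with
  | zero => simp [walk]
  | succ n ih =>
    simp only [walk, ih, ← Finset.mul_sum, h, pow_succ, mul_assoc]

lemma confined_antitone (K n : ℕ) : ∀ (y : Vtx d) {W W' : Finset (Vtx d)}, W ⊆ W' →
    confined K n y W' ≤ confined K n y W := by
  induction n with
  | zero =>
    intro y W W' h
    have := Finset.card_le_card h
    unfold confined
    split_ifs with h1 h2 <;> first | (exfalso; omega) | norm_num
  | succ n ih =>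
    intro y W W' h
    exact Finset.sum_le_sum fun s _ => ih _ (Finset.insert_subset_insert _ h)

lemma confined_eq_zero {K : ℕ} (n : ℕ) : ∀ (y : Vtx d) {W : Finset (Vtx d)}, K ≤ W.card →
    confined K n y W = 0 := by
  induction n with
  | zero =>
    intro y W h
    simp [confined, h]
  | succ n ih =>
    intro y W h
    exact Finset.sum_eq_zero fun s _ =>
      ih _ (h.trans (Finset.card_le_card (Finset.subset_insert _ _)))

lemma confined_add_le (K n l : ℕ) : ∀ (y : Vtx d) (W : Finset (Vtx d)), y ∈ W →
    confined K (n + l) y W ≤ walk l (fun x => confined K n x (insert x W)) y := by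
  induction l with
  | zero =>
    intro y W hy
    simp [walk, Finset.insert_eq_of_mem hy]
  | succ l ih =>
    intro y W hy
    refine Finset.sum_le_sum fun s _ => ?_
    refine (ih _ _ (Finset.mem_insert_self _ _)).trans (walk_mono l (fun x => ?_) _)
    exact confined_antitone K n x (Finset.insert_subset_insert _ (Finset.subset_insert _ _))

lemma confined_mul_le {K l : ℕ}
    (hl : ∀ (y : Vtx d) (W : Finset (Vtx d)), W.card < K →
      walk l (fun x => if x ∈ W then (1 : ℝ) else 0) y ≤ (2 * d : ℝ) ^ l / 2) (j : ℕ) :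
    ∀ (y : Vtx d) (W : Finset (Vtx d)), y ∈ W →
      confined K (j * l) y W ≤ (2 * d : ℝ) ^ (j * l) * ((3 / 4) ^ j * (2 ^ K / 2 ^ W.card)) := by
  induction j with
  | zero =>
    intro y W _
    rw [zero_mul]
    simp only [confined, pow_zero, one_mul]
    split_ifs with h
    · rw [one_le_div (by positivity)]
      exact pow_le_pow_right₀ one_le_two h.le
    · positivity
  | succ j ih =>
    intro y W hy
    rcases le_or_gt K W.card with hK | hK
    · rw [confined_eq_zero _ _ hK]
      positivity
    · rw [show (j + 1) * l = j * l + l by ring]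
      refine (confined_add_le K _ l y W hy).trans ?_
      set c : ℝ := (2 * d : ℝ) ^ (j * l) * ((3 / 4) ^ j * (2 ^ K / 2 ^ W.card)) with hc
      have h1 : ∀ x, confined K (j * l) x (insert x W)
          ≤ (c / 2) * 1 + (c / 2) * (if x ∈ W then (1 : ℝ) else 0) := by
        intro x
        refine (ih x _ (Finset.mem_insert_self _ _)).trans (le_of_eq ?_)
        split_ifs with hx
        · rw [Finset.insert_eq_of_mem hx, hc]
          ring
        · rw [Finset.card_insert_of_notMem hx, hc, pow_succ]
          field_simp
          ring
      refine (walk_mono l h1 y).trans ?_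
      rw [walk_add_mul, walk_const]
      have h2 := mul_le_mul_of_nonneg_left (hl y W hK) (show 0 ≤ c / 2 by positivity)
      have h3 : (2 * d : ℝ) ^ (j * l + l) * ((3 / 4) ^ (j + 1) * (2 ^ K / 2 ^ W.card))
          = c / 2 * (2 * d : ℝ) ^ l + c / 2 * ((2 * d : ℝ) ^ l / 2) := by
        rw [hc, pow_add, pow_succ (3 / 4 : ℝ)]
        ring
      rw [h3]
      linarith

/-- The constant in the heat kernel bound. -/
noncomputable def heatConst (d : ℕ) : ℝ := 4 / (1 - Real.exp (-(2 / d)))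

lemma heatConst_pos (hd : 0 < d) : 0 < heatConst d := by
  unfold heatConst
  have : Real.exp (-(2 / d)) < 1 := by
    rw [Real.exp_lt_one_iff]
    have : (0 : ℝ) < 2 / d := by positivity
    linarith
  exact div_pos (by norm_num) (by linarith)

lemma exp_cos_le (hd : 0 < d) {M j : ℕ} (hj : j < M) :
    Real.exp (-((M : ℝ) ^ 2 / d * (1 - |Real.cos (Real.pi * j / M)|)))
      ≤ Real.exp (-(2 / d)) ^ j + Real.exp (-(2 / d)) ^ (M - 1 - j) := by
  have hM : (0 : ℝ) < M := by exact_mod_cast (by omega : 0 < M)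
  have hd' : (0 : ℝ) < d := by exact_mod_cast hd
  have key : ∀ m : ℕ, 2 * (m : ℝ) / M ≤ Real.sin (Real.pi * j / M) →
      Real.exp (-((M : ℝ) ^ 2 / d * (1 - |Real.cos (Real.pi * j / M)|)))
        ≤ Real.exp (-(2 / d)) ^ m := by
    intro m hm
    rw [← Real.exp_nat_mul]
    apply Real.exp_le_exp.2
    have h1 : Real.sin (Real.pi * j / M) ^ 2 / 2 ≤ 1 - |Real.cos (Real.pi * j / M)| := by
      have := Real.sin_sq_add_cos_sq (Real.pi * j / M)
      have h2 := sq_abs (Real.cos (Real.pi * j / M))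
      nlinarith [sq_nonneg (1 - |Real.cos (Real.pi * j / M)|)]
    have h2 : (2 * (m : ℝ) / M) ^ 2 ≤ Real.sin (Real.pi * j / M) ^ 2 :=
      pow_le_pow_left₀ (by positivity) hm 2
    have h3 : (m : ℝ) ≤ (m : ℝ) ^ 2 := by
      exact_mod_cast Nat.le_self_pow two_ne_zero m
    have h4 : (M : ℝ) ^ 2 / d * ((2 * (m : ℝ) / M) ^ 2 / 2) = m ^ 2 * (2 / d) := by
      field_simp
    have h5 : (M : ℝ) ^ 2 / d * ((2 * (m : ℝ) / M) ^ 2 / 2)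
        ≤ (M : ℝ) ^ 2 / d * (1 - |Real.cos (Real.pi * j / M)|) := by
      gcongr
      linarith
    have h6 : (m : ℝ) * (2 / d) ≤ m ^ 2 * (2 / d) := by gcongr
    linarith
  have hπ := Real.pi_pos
  rcases le_or_gt (2 * j) M with h | h
  · have h' : 2 * (j : ℝ) ≤ M := by exact_mod_cast h
    have := key j (by
      have := Real.mul_le_sin (x := Real.pi * j / M) (by positivity) (by
        rw [div_le_div_iff₀ hM two_pos]
        nlinarith)
      refine le_trans (le_of_eq ?_) this
      field_simp)
    have h0 : (0 : ℝ) ≤ Real.exp (-(2 / d)) ^ (M - 1 - j) := by positivity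
    linarith
  · have h' : (M : ℝ) ≤ 2 * j := by exact_mod_cast h.le
    have hjM : (j : ℝ) + 1 ≤ M := by exact_mod_cast hj
    have hcast : ((M - 1 - j : ℕ) : ℝ) = M - 1 - j := by
      rw [Nat.cast_sub (by omega), Nat.cast_sub (by omega)]
      simp
    have := key (M - 1 - j) (by
      rw [← Real.sin_pi_sub, hcast]
      have := Real.mul_le_sin (x := Real.pi - Real.pi * j / M) (by
          rw [sub_nonneg, div_le_iff₀ hM]
          nlinarith) (by
          rw [sub_le_iff_le_add, ← sub_le_iff_le_add', le_div_iff₀ hM]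
          nlinarith)
      refine le_trans ?_ this
      rw [div_le_iff₀ hM]
      have : 2 / Real.pi * (Real.pi - Real.pi * j / M) * M = 2 * (M - j) := by
        field_simp
      rw [this]
      linarith)
    have h0 : (0 : ℝ) ≤ Real.exp (-(2 / d)) ^ j := by positivity
    linarith

lemma sum_exp_cos_le (hd : 0 < d) {M : ℕ} (hM : 0 < M) :
    ∑ j ∈ Finset.range (2 * M),
      Real.exp (-((M : ℝ) ^ 2 / d * (1 - |Real.cos (Real.pi * j / M)|))) ≤ heatConst d := by
  have hM' : (M : ℝ) ≠ 0 := by exact_mod_cast hM.ne'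
  rw [two_mul, Finset.sum_range_add]
  have hper : ∀ j : ℕ, |Real.cos (Real.pi * ((M + j : ℕ) : ℝ) / M)|
      = |Real.cos (Real.pi * j / M)| := by
    intro j
    rw [show Real.pi * ((M + j : ℕ) : ℝ) / M = Real.pi * j / M + Real.pi by
      push_cast; field_simp; ring, Real.cos_add_pi, abs_neg]
  simp only [hper]
  have hq0 : 0 ≤ Real.exp (-(2 / (d : ℝ))) := (Real.exp_pos _).le
  have hq1 : Real.exp (-(2 / (d : ℝ))) < 1 := by
    rw [Real.exp_lt_one_iff]
    have : (0 : ℝ) < 2 / d := by positivity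
    linarith
  have hgeom : ∑ j ∈ Finset.range M, Real.exp (-(2 / (d : ℝ))) ^ j
      ≤ 1 / (1 - Real.exp (-(2 / (d : ℝ)))) := by
    rw [one_div, ← tsum_geometric_of_lt_one hq0 hq1]
    exact (summable_geometric_of_lt_one hq0 hq1).sum_le_tsum _ (fun _ _ => by positivity)
  have h1 : ∑ j ∈ Finset.range M,
      Real.exp (-((M : ℝ) ^ 2 / d * (1 - |Real.cos (Real.pi * j / M)|)))
      ≤ 2 * (1 / (1 - Real.exp (-(2 / (d : ℝ))))) := by
    refine (Finset.sum_le_sum fun j hj => exp_cos_le hd (Finset.mem_range.1 hj)).trans ?_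
    rw [Finset.sum_add_distrib,
      Finset.sum_range_reflect (fun j => Real.exp (-(2 / (d : ℝ))) ^ j) M]
    linarith
  unfold heatConst
  calc _ ≤ 2 * (1 / (1 - Real.exp (-(2 / (d : ℝ))))) + 2 * (1 / (1 - Real.exp (-(2 / (d : ℝ)))))
        := add_le_add h1 h1
    _ = _ := by ring

/-- A primitive `2M`-th root of unity. -/
noncomputable def zeta (M : ℕ) : ℂ := Complex.exp (((Real.pi / M : ℝ) : ℂ) * Complex.I)

lemma zeta_ne_zero (M : ℕ) : zeta M ≠ 0 := Complex.exp_ne_zero _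

lemma norm_zeta (M : ℕ) : ‖zeta M‖ = 1 := Complex.norm_exp_ofReal_mul_I _

lemma zeta_pow {M : ℕ} (hM : 0 < M) : zeta M ^ (2 * M) = 1 := by
  have : (M : ℂ) ≠ 0 := by exact_mod_cast hM.ne'
  unfold zeta
  rw [← Complex.exp_nat_mul, Complex.exp_eq_one_iff]
  exact ⟨1, by push_cast; field_simp⟩

lemma zeta_pow_add_inv (M j : ℕ) :
    zeta M ^ (j : ℤ) + zeta M ^ (-(j : ℤ)) = ((2 * Real.cos (Real.pi * j / M) : ℝ) : ℂ) := by
  rw [zpow_neg, zpow_natCast]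
  unfold zeta
  rw [← Complex.exp_nat_mul, ← Complex.exp_neg]
  push_cast
  rw [Complex.cos]
  ring_nf

/-- The character of `ℤ^d` with frequencies `k`, centred at `x`. -/
noncomputable def chi (M : ℕ) (x : Vtx d) (k : Fin d → ℕ) (y : Vtx d) : ℂ :=
  ∏ i, zeta M ^ ((k i : ℤ) * (y i - x i))

lemma norm_chi (M : ℕ) (x : Vtx d) (k : Fin d → ℕ) (y : Vtx d) : ‖chi M x k y‖ = 1 := by
  simp [chi, norm_zeta]

lemma chi_add_vec (M : ℕ) (x : Vtx d) (k : Fin d → ℕ) (y : Vtx d) (s : Dir d) :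
    chi M x k (y + s.vec) = zeta M ^ ((k s.1 : ℤ) * s.2) * chi M x k y := by
  unfold chi
  have h : ∀ i, zeta M ^ ((k i : ℤ) * ((y + s.vec) i - x i))
      = zeta M ^ ((k i : ℤ) * s.vec i) * zeta M ^ ((k i : ℤ) * (y i - x i)) := by
    intro i
    rw [← zpow_add₀ (zeta_ne_zero M)]
    congr 1
    simp only [Pi.add_apply]
    ring
  simp only [h, Finset.prod_mul_distrib]
  congr 1
  rw [Finset.prod_eq_single s.1]
  · simp [Dir.vec]
  · intro j _ hj
    simp [Dir.vec, hj]
  · simp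

lemma sum_chi (M : ℕ) (x : Vtx d) (k : Fin d → ℕ) (y : Vtx d) :
    ∑ s : Dir d, chi M x k (y + s.vec)
      = ((∑ i, 2 * Real.cos (Real.pi * k i / M) : ℝ) : ℂ) * chi M x k y := by
  simp only [chi_add_vec, ← Finset.sum_mul]
  congr 1
  rw [Fintype.sum_prod_type, Complex.ofReal_sum]
  refine Finset.sum_congr rfl fun i _ => ?_
  rw [← zeta_pow_add_inv]
  have : (Finset.univ : Finset ℤˣ) = {1, -1} := rfl
  rw [this, Finset.sum_pair (by decide)]
  simp

lemma sum_zpow_zeta {M : ℕ} (hM : 0 < M) (z : ℤ) :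
    ∑ j ∈ Finset.range (2 * M), zeta M ^ ((j : ℤ) * z) = 0 ∨
      ∑ j ∈ Finset.range (2 * M), zeta M ^ ((j : ℤ) * z) = 2 * M := by
  have h : ∀ j : ℕ, zeta M ^ ((j : ℤ) * z) = (zeta M ^ z) ^ j := by
    intro j
    rw [mul_comm, zpow_mul, zpow_natCast]
  simp only [h]
  by_cases h1 : zeta M ^ z = 1
  · right
    simp [h1]
  · left
    rw [geom_sum_eq h1, ← zpow_natCast, ← zpow_mul, mul_comm, zpow_mul, zpow_natCast,
      zeta_pow hM]
    simp

/-- The indicator of the sites congruent to `x` modulo `2M`, as a sum of characters. -/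
noncomputable def periodized (M : ℕ) (x y : Vtx d) : ℂ :=
  ∑ k ∈ Fintype.piFinset fun _ : Fin d => Finset.range (2 * M),
    ((2 * M : ℂ) ^ d)⁻¹ * chi M x k y

lemma periodized_eq (M : ℕ) (x y : Vtx d) : periodized M x y
    = ((2 * M : ℂ) ^ d)⁻¹
      * ∏ i, ∑ j ∈ Finset.range (2 * M), zeta M ^ ((j : ℤ) * (y i - x i)) := by
  rw [Finset.prod_univ_sum, Finset.mul_sum]
  rfl

lemma indicator_le_periodized {M : ℕ} (hM : 0 < M) (x y : Vtx d) :
    (if y = x then (1 : ℝ) else 0) ≤ (periodized M x y).re := by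
  have hM' : (2 * M : ℂ) ≠ 0 := by
    have : (M : ℂ) ≠ 0 := by exact_mod_cast hM.ne'
    simpa using this
  rw [periodized_eq]
  split_ifs with h
  · subst h
    simp [hM.ne']
  · by_cases h0 : ∃ i, ∑ j ∈ Finset.range (2 * M), zeta M ^ ((j : ℤ) * (y i - x i)) = 0
    · obtain ⟨i, hi⟩ := h0
      rw [Finset.prod_eq_zero (Finset.mem_univ i) hi]
      simp
    · push Not at h0
      rw [Finset.prod_congr rfl fun i _ => (sum_zpow_zeta hM (y i - x i)).resolve_left (h0 i)]
      simp [hM.ne']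

lemma abs_sum_cos_pow_le (hd : 0 < d) (M : ℕ) (k : Fin d → ℕ) :
    |∑ i, 2 * Real.cos (Real.pi * k i / M)| ^ (M ^ 2) ≤ (2 * d : ℝ) ^ (M ^ 2)
      * ∏ i, Real.exp (-((M : ℝ) ^ 2 / d * (1 - |Real.cos (Real.pi * k i / M)|))) := by
  have hd' : (0 : ℝ) < d := by exact_mod_cast hd
  have h1 : |∑ i, 2 * Real.cos (Real.pi * k i / M)|
      ≤ 2 * d * Real.exp (-(∑ i, (1 - |Real.cos (Real.pi * k i / M)|)) / d) := by
    refine (Finset.abs_sum_le_sum_abs _ _).trans ?_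
    have h2 := Real.add_one_le_exp (-(∑ i, (1 - |Real.cos (Real.pi * k i / M)|)) / d)
    refine le_trans (le_of_eq ?_) (mul_le_mul_of_nonneg_left h2 (by positivity))
    simp only [abs_mul, Finset.sum_sub_distrib, Finset.sum_const, Finset.card_univ,
      Fintype.card_fin, nsmul_eq_mul, ← Finset.mul_sum]
    rw [abs_two]
    field_simp
    ring
  refine (pow_le_pow_left₀ (abs_nonneg _) h1 _).trans (le_of_eq ?_)
  rw [mul_pow, ← Real.exp_sum, ← Real.exp_nat_mul]
  congr 2
  push_cast
  rw [Finset.sum_neg_distrib, ← Finset.mul_sum]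
  field_simp

lemma walk_single_le (hd : 0 < d) {M : ℕ} (hM : 0 < M) (x y : Vtx d) :
    walk (M ^ 2) (fun z => if z = x then (1 : ℝ) else 0) y
      ≤ (2 * d : ℝ) ^ (M ^ 2) * (heatConst d / (2 * M)) ^ d := by
  refine (walk_mono _ (indicator_le_periodized hM x) y).trans ?_
  rw [walk_re]
  refine (Complex.re_le_norm _).trans ?_
  unfold periodized
  rw [walk_sum_mul]
  refine (norm_sum_le _ _).trans ?_
  have h1 : ∀ k ∈ Fintype.piFinset fun _ : Fin d => Finset.range (2 * M),
      ‖((2 * M : ℂ) ^ d)⁻¹ * walk (M ^ 2) (chi M x k) y‖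
      ≤ ((2 * M : ℝ) ^ d)⁻¹ * ((2 * d : ℝ) ^ (M ^ 2)
      * ∏ i, Real.exp (-((M : ℝ) ^ 2 / d * (1 - |Real.cos (Real.pi * k i / M)|)))) := by
    intro k _
    rw [walk_eigen _ _ _ (sum_chi M x k), norm_mul, norm_mul, norm_chi, mul_one, norm_pow,
      Complex.norm_real, Real.norm_eq_abs]
    have : ‖((2 * M : ℂ) ^ d)⁻¹‖ = ((2 * M : ℝ) ^ d)⁻¹ := by simp
    rw [this]
    exact mul_le_mul_of_nonneg_left (abs_sum_cos_pow_le hd M k) (by positivity)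
  refine (Finset.sum_le_sum h1).trans ?_
  rw [← Finset.mul_sum, ← Finset.mul_sum, ← Finset.prod_univ_sum (fun _ => Finset.range (2 * M))
    (fun _ j => Real.exp (-((M : ℝ) ^ 2 / d * (1 - |Real.cos (Real.pi * (j : ℕ) / M)|))))]
  rw [Finset.prod_const, Finset.card_univ, Fintype.card_fin, div_pow]
  have h2 := pow_le_pow_left₀ (Finset.sum_nonneg fun j _ => (Real.exp_pos _).le)
    (sum_exp_cos_le hd hM) d
  have : (2 * d : ℝ) ^ (M ^ 2) * (heatConst d ^ d / (2 * M : ℝ) ^ d)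
      = ((2 * M : ℝ) ^ d)⁻¹ * ((2 * d : ℝ) ^ (M ^ 2) * heatConst d ^ d) := by
    ring
  rw [this]
  gcongr

lemma walk_mem_le (hd : 0 < d) {M : ℕ} (hM : 0 < M) (y : Vtx d) (W : Finset (Vtx d)) :
    walk (M ^ 2) (fun z => if z ∈ W then (1 : ℝ) else 0) y
      ≤ (2 * d : ℝ) ^ (M ^ 2) * (W.card * (heatConst d / (2 * M)) ^ d) := by
  have h1 : (fun z => if z ∈ W then (1 : ℝ) else 0)
      = fun z : Vtx d => ∑ x ∈ W, 1 * (if z = x then (1 : ℝ) else 0) := by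
    ext z
    simp
  rw [h1, walk_sum_mul]
  refine (Finset.sum_le_sum fun x _ => mul_le_mul_of_nonneg_left (walk_single_le hd hM x y)
    zero_le_one).trans (le_of_eq ?_)
  rw [Finset.sum_const, nsmul_eq_mul]
  ring

lemma fixesOff_one (W : Finset (Vtx d)) : FixesOff {(1 : Equiv.Perm (Vtx d))} W := by
  intro σ hσ z _
  rw [Finset.mem_singleton.1 hσ]
  rfl

lemma T_le (hd : 2 ≤ d) (β : ℝ) (hβ : 1 ≤ β)
    (hβ' : β ^ 4 * ((2 * d : ℝ) ^ 4 - 1) ≤ (2 * d : ℝ) ^ 4) {M : ℕ} (hM : 0 < M) (K : ℕ)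
    (hK : K * (heatConst d / (2 * M)) ^ d ≤ 1 / 2) (j : ℕ) :
    (T (j * M ^ 2) d : ℝ)
      ≤ (2 * d : ℝ) ^ (j * M ^ 2) * (β ^ 4 / β ^ K + (3 / 4) ^ j * 2 ^ K) := by
  have hpos : 0 ≤ heatConst d := (heatConst_pos (by omega)).le
  have h1 := total_le_confined hd K β hβ hβ' (j * M ^ 2) 0 {0} {1} 1 (by simp)
    (fixesOff_one _)
  have h2 := confined_mul_le (d := d) (K := K) (l := M ^ 2) (by
    intro y W hW
    refine (walk_mem_le (by omega) hM y W).trans ?_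
    rw [div_eq_mul_inv ((2 * d : ℝ) ^ (M ^ 2)) 2]
    have : (W.card : ℝ) ≤ K := by exact_mod_cast hW.le
    refine mul_le_mul_of_nonneg_left (le_trans ?_ (hK.trans_eq (one_div 2))) (by positivity)
    gcongr) j 0 {0} (by simp)
  simp only [total, Finset.sum_singleton, Finset.card_singleton, inv_one, one_mul] at h1
  rw [← T_eq_cnt] at h1
  refine h1.trans ?_
  rw [mul_add]
  refine add_le_add le_rfl (h2.trans ?_)
  rw [Finset.card_singleton, pow_one]
  have : (0 : ℝ) ≤ 2 ^ K := by positivity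
  gcongr
  linarith

lemma rpow_neg_half (d : ℕ) {ε : ℝ} (hε : 0 < ε) :
    ε ^ (-(d : ℝ) / 2) = (√ε)⁻¹ ^ d := by
  rw [← Real.rpow_natCast, Real.sqrt_eq_rpow, ← Real.rpow_neg hε.le, ← Real.rpow_mul hε.le]
  congr 1
  ring

lemma exists_T_le_exp (hd : 2 ≤ d) : ∃ a > (0 : ℝ), ∃ b > (0 : ℝ), ∃ A > (0 : ℝ),
    ∀ M K : ℕ, 0 < M → (K : ℝ) ≤ a * (M : ℝ) ^ d →
      (T (4 * K * M ^ 2) d : ℝ) ≤ (2 * d : ℝ) ^ (4 * K * M ^ 2) * (A * Real.exp (-(b * K))) := by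
  have hh : 0 < heatConst d := heatConst_pos (by omega)
  have hd' : (2 : ℝ) ≤ d := by exact_mod_cast hd
  have hq : (1 : ℝ) < (2 * d : ℝ) ^ 4 := one_lt_pow₀ (by linarith) (by norm_num)
  set q : ℝ := (2 * d : ℝ) ^ 4
  have hq1 : 1 < q / (q - 1) := by
    rw [one_lt_div (by linarith)]
    linarith
  set β : ℝ := (q / (q - 1)) ^ (1 / 4 : ℝ) with hβdef
  have hβ : 1 < β := Real.one_lt_rpow hq1 (by norm_num)
  have hβ4 : β ^ 4 = q / (q - 1) := by
    rw [hβdef, ← Real.rpow_natCast, ← Real.rpow_mul (by linarith)]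
    norm_num
  refine ⟨(2 / heatConst d) ^ d / 2, by positivity, min (Real.log β) (Real.log (128 / 81)),
    lt_min (Real.log_pos hβ) (Real.log_pos (by norm_num)), β ^ 4 + 1, by positivity, ?_⟩
  intro M K hM hK
  have hM' : (0 : ℝ) < M := by exact_mod_cast hM
  have h := T_le hd β hβ.le (by
    rw [hβ4, div_mul_cancel₀ _ (by linarith)]) hM K (by
    calc K * (heatConst d / (2 * M)) ^ d
        ≤ (2 / heatConst d) ^ d / 2 * (M : ℝ) ^ d * (heatConst d / (2 * M)) ^ d := by gcongr
      _ = 1 / 2 := by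
        rw [div_pow, div_pow, mul_pow]
        field_simp) (4 * K)
  refine h.trans (mul_le_mul_of_nonneg_left ?_ (by positivity))
  rw [add_mul, one_mul]
  have e1 : ∀ x : ℝ, 1 < x → min (Real.log β) (Real.log (128 / 81)) ≤ Real.log x →
      (x ^ K)⁻¹ ≤ Real.exp (-(min (Real.log β) (Real.log (128 / 81)) * K)) := by
    intro x hx h
    have : x ^ K = Real.exp (K * Real.log x) := by
      rw [Real.exp_nat_mul, Real.exp_log (by linarith)]
    rw [this, ← Real.exp_neg]
    apply Real.exp_le_exp.2
    rw [mul_comm]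
    gcongr
  refine add_le_add ?_ ?_
  · rw [div_eq_mul_inv]
    gcongr
    exact e1 β hβ (min_le_left _ _)
  · refine le_of_eq_of_le ?_ (e1 (128 / 81) (by norm_num) (min_le_right _ _))
    rw [pow_mul, ← mul_pow, ← inv_pow]
    norm_num

lemma ae_mem_of_Icc {μ : Measure ℝ} [IsProbabilityMeasure μ] {a b : ℝ}
    (h : μ (Set.Icc a b) = 1) : ∀ᵐ x ∂μ, x ∈ Set.Icc a b := by
  rw [← prob_compl_eq_zero_iff measurableSet_Icc] at h
  exact h

lemma integrable_of_Icc {μ : Measure ℝ} [IsProbabilityMeasure μ] {a b : ℝ}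
    (h : μ (Set.Icc a b) = 1) {f : ℝ → ℝ} (hf : Continuous f) : Integrable f μ := by
  obtain ⟨C, hC⟩ := (isCompact_Icc (a := a) (b := b)).exists_bound_of_continuousOn hf.continuousOn
  refine Integrable.of_bound hf.aestronglyMeasurable C ?_
  filter_upwards [ae_mem_of_Icc h] with x hx using hC x hx

lemma measure_Iic_mul_pow_le {μ : Measure ℝ} [IsProbabilityMeasure μ] {b r : ℝ}
    (h : μ (Set.Icc (-b) b) = 1) (hr : 0 ≤ r) {n : ℕ} (hn : Even n) :
    (μ (Set.Iic (-r))).toReal * r ^ n ≤ ∫ x, x ^ n ∂μ := by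
  have h1 : (μ (Set.Iic (-r))).toReal * r ^ n
      = ∫ x, (Set.Iic (-r)).indicator (fun _ => r ^ n) x ∂μ := by
    rw [integral_indicator measurableSet_Iic, integral_const]
    simp [Measure.real]
  rw [h1]
  refine integral_mono_of_nonneg ?_ (integrable_of_Icc h (continuous_pow n)) ?_
  · exact Filter.Eventually.of_forall fun x => Set.indicator_nonneg (fun _ _ => by positivity) x
  · refine Filter.Eventually.of_forall fun x => ?_
    refine Set.indicator_apply_le' (fun hx => ?_) fun _ => hn.pow_nonneg x
    change r ^ n ≤ x ^ n
    rw [← hn.neg_pow x]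
    exact pow_le_pow_left₀ hr (by linarith [Set.mem_Iic.1 hx]) n

lemma exp_neg_two_mul_le {x : ℝ} (h0 : 0 ≤ x) (h1 : x ≤ 1 / 2) : Real.exp (-(2 * x)) ≤ 1 - x := by
  rw [Real.exp_neg, inv_le_iff_one_le_mul₀ (Real.exp_pos _)]
  have := Real.add_one_le_exp (2 * x)
  nlinarith

lemma upper_bound (hd : 2 ≤ d) : ∃ C > (0 : ℝ), ∃ c > (0 : ℝ),
    ∀ μ : Measure ℝ, IsProbabilityMeasure μ →
      μ (Set.Icc (-(2 * d : ℝ)) (2 * d)) = 1 →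
      (∀ n : ℕ, ∫ x, x ^ n ∂μ = (T n d : ℝ)) →
      ∀ ε : ℝ, 0 < ε → ε ≤ 1 →
        (μ (Set.Iic (-(2 * d : ℝ) + ε))).toReal
          ≤ C * Real.exp (-(c * ε ^ (-(d : ℝ) / 2))) := by
  obtain ⟨a, ha, b, hb, A, hA, hT⟩ := exists_T_le_exp hd
  have hd' : (2 : ℝ) ≤ d := by exact_mod_cast hd
  set κ : ℝ := √b / 2 with hκ
  have hκ0 : 0 < κ := by positivity
  have hκ2 : κ ^ 2 = b / 4 := by
    rw [hκ, div_pow, Real.sq_sqrt hb.le]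
    norm_num
  refine ⟨A * Real.exp (b / 2) + Real.exp (a * b / 2), by positivity,
    b / 2 * (a * (κ / 2) ^ d), by positivity, ?_⟩
  intro μ _ hsupp hmom ε hε hε1
  rw [rpow_neg_half d hε]
  have hs : 0 < √ε := Real.sqrt_pos.2 hε
  set u : ℝ := (√ε)⁻¹ with hu
  have hu0 : 0 < u := by positivity
  have hu2 : u ^ 2 * ε = 1 := by
    rw [hu, inv_pow, Real.sq_sqrt hε.le, inv_mul_cancel₀ hε.ne']
  have hle1 : (μ (Set.Iic (-(2 * d : ℝ) + ε))).toReal ≤ 1 := by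
    have := prob_le_one (μ := μ) (s := Set.Iic (-(2 * d : ℝ) + ε))
    exact ENNReal.toReal_le_of_le_ofReal zero_le_one (by simpa using this)
  rw [add_mul]
  rcases le_or_gt (κ * u) 2 with hsmall | hbig
  · have h1 : κ / 2 * u ≤ 1 := by linarith
    have h2 : (κ / 2) ^ d * u ^ d ≤ 1 := by
      rw [← mul_pow]
      exact pow_le_one₀ (by positivity) h1
    have h3 : 1 ≤ Real.exp (a * b / 2) * Real.exp (-(b / 2 * (a * (κ / 2) ^ d) * u ^ d)) := by
      rw [← Real.exp_add]
      apply Real.one_le_exp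
      have : 0 < a * b / 2 := by positivity
      nlinarith
    have : 0 ≤ A * Real.exp (b / 2) * Real.exp (-(b / 2 * (a * (κ / 2) ^ d) * u ^ d)) := by
      positivity
    linarith
  · set M : ℕ := ⌊κ * u⌋₊
    have hM1 : (M : ℝ) ≤ κ * u := Nat.floor_le (by positivity)
    have hM2 : κ / 2 * u ≤ M := by linarith [Nat.lt_floor_add_one (κ * u)]
    have hM0 : 0 < M := by
      have : (0 : ℝ) < M := lt_of_lt_of_le (by positivity) hM2
      exact_mod_cast this
    set K : ℕ := ⌊a * (M : ℝ) ^ d⌋₊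
    have hK1 : (K : ℝ) ≤ a * (M : ℝ) ^ d := Nat.floor_le (by positivity)
    have hK2 : a * (κ / 2) ^ d * u ^ d - 1 ≤ K := by
      have : a * (κ / 2 * u) ^ d ≤ a * (M : ℝ) ^ d := by gcongr
      rw [mul_pow] at this
      linarith [Nat.lt_floor_add_one (a * (M : ℝ) ^ d)]
    have hr : 0 < 2 * (d : ℝ) - ε := by linarith
    have hmk := measure_Iic_mul_pow_le hsupp hr.le (n := 4 * K * M ^ 2)
      ⟨2 * K * M ^ 2, by ring⟩
    rw [hmom, neg_sub, ← neg_add_eq_sub] at hmk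
    have hmk2 := hmk.trans (hT M K hM0 hK1)
    have hexp : (2 * d : ℝ) ^ (4 * K * M ^ 2) * Real.exp (-(b * K / 2))
        ≤ (2 * d - ε) ^ (4 * K * M ^ 2) := by
      have h1 := exp_neg_two_mul_le (x := ε / (2 * d)) (by positivity) (by
        rw [div_le_iff₀ (by positivity)]
        linarith)
      have h2 : (2 * (d : ℝ) - ε) = 2 * d * (1 - ε / (2 * d)) := by
        field_simp
      rw [h2, mul_pow (2 * (d : ℝ)) (1 - ε / (2 * d))]
      refine mul_le_mul_of_nonneg_left ?_ (by positivity)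
      refine le_trans ?_ (pow_le_pow_left₀ (Real.exp_pos _).le h1 _)
      rw [← Real.exp_nat_mul]
      apply Real.exp_le_exp.2
      have h3 : (M : ℝ) ^ 2 * ε ≤ b / 4 := by
        calc (M : ℝ) ^ 2 * ε ≤ (κ * u) ^ 2 * ε := by gcongr
          _ = b / 4 := by rw [mul_pow, mul_assoc, hu2, hκ2, mul_one]
      have h4 : 2 * (ε / (2 * d)) ≤ ε / 2 := by
        rw [← mul_div_assoc, mul_div_mul_left _ _ (two_ne_zero' ℝ)]
        gcongr
      push_cast
      have h5 : (4 * K * (M : ℝ) ^ 2) * (2 * (ε / (2 * d))) ≤ 4 * K * (M : ℝ) ^ 2 * (ε / 2) := by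
        gcongr
      have h6 : (K : ℝ) * ((M : ℝ) ^ 2 * ε) ≤ K * (b / 4) := by gcongr
      nlinarith
    have hpos : 0 < (2 * d : ℝ) ^ (4 * K * M ^ 2) := by positivity
    have hfin : (μ (Set.Iic (-(2 * d : ℝ) + ε))).toReal ≤ A * Real.exp (-(b * K / 2)) := by
      have h1 := (mul_le_mul_of_nonneg_left hexp ENNReal.toReal_nonneg).trans hmk2
      have h2 : Real.exp (-(b * K)) = Real.exp (-(b * K / 2)) * Real.exp (-(b * K / 2)) := by
        rw [← Real.exp_add]
        congr 1
        ring
      rw [h2] at h1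
      refine le_of_mul_le_mul_right ?_ (mul_pos hpos (Real.exp_pos (-(b * K / 2))))
      refine h1.trans (le_of_eq ?_)
      ring
    refine hfin.trans ?_
    have h1 : A * Real.exp (-(b * K / 2)) ≤ A * Real.exp (b / 2) *
        Real.exp (-(b / 2 * (a * (κ / 2) ^ d) * u ^ d)) := by
      rw [mul_assoc, ← Real.exp_add]
      gcongr
      nlinarith
    have : 0 < Real.exp (a * b / 2) * Real.exp (-(b / 2 * (a * (κ / 2) ^ d) * u ^ d)) := by
      positivity
    linarith

lemma sum_dir_opp {R : Type*} [AddCommMonoid R] (f : Dir d → R) :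
    ∑ s : Dir d, f s.opp = ∑ s, f s :=
  Equiv.sum_comp (⟨Dir.opp, Dir.opp, Dir.opp_opp, Dir.opp_opp⟩ : Dir d ≃ Dir d) f

lemma cnt_succ_last (n : ℕ) : ∀ (x : Vtx d) (σ : Equiv.Perm (Vtx d)),
    cnt (n + 1) x σ = ∑ s : Dir d, cnt n x (σ * Equiv.swap (σ⁻¹ x) (σ⁻¹ x + s.vec)) := by
  induction n with
  | zero =>
    intro x σ
    rw [← sum_dir_opp]
    simp only [cnt]
    refine Finset.sum_congr rfl fun s _ => ?_
    congr 1
    rw [eq_iff_iff, Dir.vec_opp]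
    constructor
    · intro h
      have h1 : σ = Equiv.swap x (x + s.vec) := by
        rw [← inv_eq_of_mul_eq_one_right h, Equiv.swap_inv]
      rw [h1, Equiv.swap_inv, Equiv.swap_apply_left, add_neg_cancel_right,
        Equiv.swap_comm (x + s.vec), Equiv.swap_mul_self]
    · intro h
      have h1 : σ = Equiv.swap (σ⁻¹ x) (σ⁻¹ x + -s.vec) := by
        conv_lhs => rw [eq_inv_of_mul_eq_one_left h, Equiv.swap_inv]
      have h2 : x = σ⁻¹ x + -s.vec := by
        have h3 := Equiv.swap_apply_left (σ⁻¹ x) (σ⁻¹ x + -s.vec)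
        rw [← h1] at h3
        simpa using h3
      have h4 : σ⁻¹ x = x + s.vec := by
        conv_rhs => rw [h2]
        simp
      rw [h4, add_neg_cancel_right, Equiv.swap_comm] at h1
      conv_lhs => rw [h1]
      exact Equiv.swap_mul_self _ _
  | succ n ih =>
    intro x σ
    rw [cnt]
    simp only [fun s : Dir d => ih (x + s.vec), mul_inv_rev, Equiv.swap_inv,
      Equiv.Perm.mul_apply, Equiv.swap_apply_right]
    rw [Finset.sum_comm]
    refine Finset.sum_congr rfl fun s _ => ?_
    rw [cnt]
    simp only [mul_assoc]

lemma cnt_inv (n : ℕ) : ∀ (x : Vtx d) (σ : Equiv.Perm (Vtx d)),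
    cnt n (σ⁻¹ x) σ⁻¹ = cnt n x σ := by
  induction n with
  | zero =>
    intro x σ
    have h : σ⁻¹ = 1 ↔ σ = 1 := inv_eq_one
    by_cases hσ : σ = 1
    · simp only [cnt, if_pos hσ, if_pos (h.2 hσ)]
    · simp only [cnt, if_neg hσ, if_neg (mt h.1 hσ)]
  | succ n ih =>
    intro x σ
    rw [cnt_succ_last n x σ, cnt]
    refine Finset.sum_congr rfl fun s _ => ?_
    rw [← ih x, mul_inv_rev, Equiv.swap_inv, Equiv.Perm.mul_apply, Equiv.swap_apply_left]

lemma sum_cnt_mul_cnt_le (m n : ℕ) : ∀ (x : Vtx d) (τ : Equiv.Perm (Vtx d))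
    (P : Finset (Equiv.Perm (Vtx d))),
    ∑ σ ∈ P, cnt m x σ * cnt n (σ⁻¹ x) (σ⁻¹ * τ) ≤ cnt (m + n) x τ := by
  induction m with
  | zero =>
    intro x τ P
    classical
    rw [zero_add]
    calc ∑ σ ∈ P, cnt 0 x σ * cnt n (σ⁻¹ x) (σ⁻¹ * τ)
        = ∑ σ ∈ P, if σ = 1 then cnt n x τ else 0 := by
          refine Finset.sum_congr rfl fun σ _ => ?_
          by_cases h : σ = 1 <;> simp [cnt, h]
      _ ≤ cnt n x τ := by
          rw [Finset.sum_ite_eq']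
          split_ifs <;> simp
  | succ m ih =>
    intro x τ P
    classical
    rw [add_right_comm]
    simp only [cnt, Finset.sum_mul]
    rw [Finset.sum_comm]
    refine Finset.sum_le_sum fun s _ => ?_
    refine le_trans (le_of_eq ?_) (ih _ _ (P.image (Equiv.swap x (x + s.vec) * ·)))
    rw [Finset.sum_image (fun _ _ _ _ h => mul_left_cancel h)]
    refine Finset.sum_congr rfl fun σ _ => ?_
    congr 2
    · simp
    · rw [mul_inv_rev, Equiv.swap_inv, mul_assoc, ← mul_assoc (Equiv.swap x _),
        Equiv.swap_mul_self, one_mul]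

lemma sum_cnt_sq_le (n : ℕ) (x : Vtx d) (P : Finset (Equiv.Perm (Vtx d))) :
    ∑ σ ∈ P, cnt n x σ ^ 2 ≤ cnt (2 * n) x 1 := by
  refine le_trans (le_of_eq ?_) ((two_mul n).symm ▸ sum_cnt_mul_cnt_le n n x 1 P)
  refine Finset.sum_congr rfl fun σ _ => ?_
  rw [mul_one, cnt_inv, sq]

/-- The box of side length `2R+1` around the origin. -/
noncomputable def box (d R : ℕ) : Finset (Vtx d) := Fintype.piFinset fun _ => Finset.Icc (-(R : ℤ)) R

lemma mem_box {R : ℕ} {x : Vtx d} : x ∈ box d R ↔ ∀ i, -(R : ℤ) ≤ x i ∧ x i ≤ R := by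
  simp [box]

lemma card_box (d R : ℕ) : (box d R).card = (2 * R + 1) ^ d := by
  rw [box, Fintype.card_piFinset_const, Int.card_Icc]
  congr 1
  omega

/-- A product of cosines, the Dirichlet ground state of a box for a suitable `θ`. -/
noncomputable def ground (θ : ℝ) (x : Vtx d) : ℝ := ∏ i, Real.cos (θ * x i)

lemma ground_le_one (θ : ℝ) (x : Vtx d) : ground θ x ≤ 1 := by
  refine (le_abs_self _).trans ?_
  rw [ground, Finset.abs_prod]
  exact Finset.prod_le_one (fun _ _ => abs_nonneg _) fun _ _ => Real.abs_cos_le_one _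

lemma ground_zero (θ : ℝ) : ground θ (0 : Vtx d) = 1 := by
  simp [ground]

lemma ground_add_vec (θ : ℝ) (x : Vtx d) (s : Dir d) :
    ground θ (x + s.vec) = Real.cos (θ * x s.1 + θ * (s.2 : ℤ)) *
      ∏ j ∈ Finset.univ.erase s.1, Real.cos (θ * x j) := by
  rw [ground, ← Finset.mul_prod_erase _ _ (Finset.mem_univ s.1)]
  congr 1
  · simp [Dir.vec, mul_add]
  · refine Finset.prod_congr rfl fun j hj => ?_
    simp [Dir.vec, Pi.single_eq_of_ne (Finset.ne_of_mem_erase hj)]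

lemma sum_ground (θ : ℝ) (x : Vtx d) :
    ∑ s : Dir d, ground θ (x + s.vec) = 2 * d * Real.cos θ * ground θ x := by
  have h : ∀ i : Fin d, ∑ u : ℤˣ, ground θ (x + Dir.vec (i, u)) = 2 * Real.cos θ * ground θ x := by
    intro i
    have hx : ground θ x = Real.cos (θ * x i) *
        ∏ j ∈ Finset.univ.erase i, Real.cos (θ * x j) := by
      rw [ground, ← Finset.mul_prod_erase _ _ (Finset.mem_univ i)]
    have hu : (Finset.univ : Finset ℤˣ) = {1, -1} := rfl
    rw [hu, Finset.sum_pair (by decide), ground_add_vec, ground_add_vec, hx]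
    simp only [Units.val_one, Units.val_neg, Int.cast_one, Int.cast_neg, mul_one, mul_neg,
      Real.cos_add, Real.cos_neg, Real.sin_neg]
    ring
  rw [Fintype.sum_prod_type, Finset.sum_congr rfl fun i _ => h i]
  simp
  ring

lemma ground_eq_zero {R : ℕ} {x : Vtx d} (hx : x ∈ box d R) (s : Dir d)
    (hs : x + s.vec ∉ box d R) : ground (Real.pi / (2 * (R + 1))) (x + s.vec) = 0 := by
  rw [ground_add_vec]
  convert zero_mul _
  rw [mem_box] at hx hs
  have hne : (R : ℝ) + 1 ≠ 0 := by positivity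
  have h1 : ¬(-(R : ℤ) ≤ x s.1 + (s.2 : ℤ) ∧ x s.1 + (s.2 : ℤ) ≤ R) := by
    intro h
    refine hs fun i => ?_
    by_cases hi : i = s.1
    · subst hi
      simpa [Dir.vec] using h
    · simpa [Dir.vec, Pi.single_eq_of_ne hi] using hx i
  have h2 := hx s.1
  have h3 : x s.1 + (s.2 : ℤ) = R + 1 ∨ x s.1 + (s.2 : ℤ) = -(R + 1) := by
    rcases Int.units_eq_one_or s.2 with h | h <;> rw [h] at h1 ⊢ <;>
      simp only [Units.val_one, Units.val_neg] at h1 ⊢ <;> omega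
  rw [← mul_add]
  rcases h3 with h | h
  · have : (x s.1 : ℝ) + ((s.2 : ℤ) : ℝ) = R + 1 := by exact_mod_cast h
    rw [this, show Real.pi / (2 * ((R : ℝ) + 1)) * (R + 1) = Real.pi / 2 by field_simp]
    exact Real.cos_pi_div_two
  · have : (x s.1 : ℝ) + ((s.2 : ℤ) : ℝ) = -(R + 1) := by exact_mod_cast h
    rw [this, show Real.pi / (2 * ((R : ℝ) + 1)) * -(R + 1) = -(Real.pi / 2) by field_simp,
      Real.cos_neg]
    exact Real.cos_pi_div_two

lemma ground_le_sum_cnt (R n : ℕ) : ∀ x ∈ box d R,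
    (2 * d * Real.cos (Real.pi / (2 * (R + 1)))) ^ n * ground (Real.pi / (2 * (R + 1))) x
      ≤ ∑ g : Equiv.Perm (box d R), (cnt n x (Equiv.Perm.ofSubtype g) : ℝ) := by
  induction n with
  | zero =>
    intro x _
    rw [pow_zero, one_mul]
    refine (ground_le_one _ _).trans ?_
    refine le_trans (le_of_eq ?_) (Finset.single_le_sum
      (f := fun g : Equiv.Perm (box d R) => (cnt 0 x (Equiv.Perm.ofSubtype g) : ℝ))
      (fun _ _ => Nat.cast_nonneg _) (Finset.mem_univ 1))
    simp [cnt]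
  | succ n ih =>
    intro x hx
    rw [pow_succ, mul_assoc, ← sum_ground, Finset.mul_sum]
    simp only [cnt, Nat.cast_sum]
    rw [Finset.sum_comm]
    refine Finset.sum_le_sum fun s _ => ?_
    by_cases hs : x + s.vec ∈ box d R
    · refine (ih _ hs).trans (le_of_eq ?_)
      rw [← Equiv.sum_comp (Equiv.mulLeft (Equiv.swap (⟨x, hx⟩ : box d R) ⟨x + s.vec, hs⟩))]
      refine Finset.sum_congr rfl fun g _ => ?_
      rw [Equiv.coe_mulLeft, map_mul, Equiv.Perm.ofSubtype_swap_eq]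
    · rw [ground_eq_zero hx s hs, mul_zero]
      exact Finset.sum_nonneg fun _ _ => Nat.cast_nonneg _

lemma le_T_two_mul (d R m : ℕ) :
    (2 * d * Real.cos (Real.pi / (2 * (R + 1)))) ^ (2 * m) / (((2 * R + 1) ^ d).factorial : ℝ)
      ≤ T (2 * m) d := by
  classical
  have h0 : (0 : Vtx d) ∈ box d R := by simp [mem_box]
  have hcos : 0 ≤ Real.cos (Real.pi / (2 * (R + 1))) := by
    apply Real.cos_nonneg_of_mem_Icc
    constructor
    · have : 0 ≤ Real.pi / (2 * ((R : ℝ) + 1)) := by positivity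
      linarith [Real.pi_pos]
    · apply div_le_div_of_nonneg_left Real.pi_pos.le two_pos
      have : (0 : ℝ) ≤ R := Nat.cast_nonneg R
      linarith
  have h1 := ground_le_sum_cnt R m 0 h0
  rw [ground_zero, mul_one] at h1
  have h2 := sq_sum_le_card_mul_sum_sq (s := Finset.univ)
    (f := fun g : Equiv.Perm (box d R) => (cnt m 0 (Equiv.Perm.ofSubtype g) : ℝ))
  have h3 : ∑ g : Equiv.Perm (box d R), (cnt m (0 : Vtx d) (Equiv.Perm.ofSubtype g) : ℝ) ^ 2
      ≤ T (2 * m) d := by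
    have := sum_cnt_sq_le m (0 : Vtx d)
      (Finset.univ.map ⟨Equiv.Perm.ofSubtype (p := (· ∈ box d R)),
        Equiv.Perm.ofSubtype_injective⟩)
    rw [Finset.sum_map] at this
    rw [T_eq_cnt]
    exact_mod_cast this
  rw [Finset.card_univ, Fintype.card_perm, Fintype.card_coe, card_box] at h2
  rw [div_le_iff₀' (by positivity), mul_comm 2 m, pow_mul]
  refine (pow_le_pow_left₀ (by positivity) h1 2).trans (h2.trans ?_)
  rw [mul_comm m 2]
  gcongr

lemma integral_polynomial_comp_neg {μ : Measure ℝ} [IsProbabilityMeasure μ] {b : ℝ}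
    (h : μ (Set.Icc (-b) b) = 1) (hodd : ∀ n : ℕ, Odd n → ∫ x, x ^ n ∂μ = 0)
    (p : Polynomial ℝ) : ∫ x, p.eval (-x) ∂μ = ∫ x, p.eval x ∂μ := by
  induction p using Polynomial.induction_on' with
  | add p q hp hq =>
    simp only [Polynomial.eval_add]
    rw [integral_add, integral_add, hp, hq] <;> exact integrable_of_Icc h (by fun_prop)
  | monomial n a =>
    simp only [Polynomial.eval_monomial, integral_const_mul]
    rcases Nat.even_or_odd n with hn | hn
    · simp only [hn.neg_pow]
    · simp only [hn.neg_pow, integral_neg, hodd n hn, neg_zero]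

lemma map_neg_eq_self {μ : Measure ℝ} [IsProbabilityMeasure μ] {b : ℝ}
    (h : μ (Set.Icc (-b) b) = 1) (hodd : ∀ n : ℕ, Odd n → ∫ x, x ^ n ∂μ = 0) :
    μ.map (fun x => -x) = μ := by
  have hmap : IsProbabilityMeasure (μ.map fun x => -x) :=
    Measure.isProbabilityMeasure_map measurable_neg.aemeasurable
  refine ext_of_forall_integral_eq_of_IsFiniteMeasure fun f => ?_
  rw [integral_map measurable_neg.aemeasurable f.continuous.aestronglyMeasurable]
  have hae := ae_mem_of_Icc h
  refine eq_of_forall_dist_le fun ε hε => ?_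
  obtain ⟨p, hp⟩ := exists_polynomial_near_of_continuousOn (-b) b f f.continuous.continuousOn
    (ε / 2) (by positivity)
  have h1 : ‖∫ x, (f (-x) - p.eval (-x)) ∂μ‖ ≤ ε / 2 := by
    refine (norm_integral_le_of_norm_le_const (C := ε / 2) ?_).trans (by simp)
    filter_upwards [hae] with x hx
    rw [norm_sub_rev]
    exact (hp (-x) ⟨by linarith [hx.2], by linarith [hx.1]⟩).le
  have h2 : ‖∫ x, (f x - p.eval x) ∂μ‖ ≤ ε / 2 := by
    refine (norm_integral_le_of_norm_le_const (C := ε / 2) ?_).trans (by simp)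
    filter_upwards [hae] with x hx
    rw [norm_sub_rev]
    exact (hp x hx).le
  have hf := f.continuous
  rw [integral_sub (integrable_of_Icc h (by fun_prop)) (integrable_of_Icc h (by fun_prop)),
    Real.norm_eq_abs, abs_le] at h1 h2
  rw [integral_polynomial_comp_neg h hodd] at h1
  rw [Real.dist_eq, abs_le]
  constructor <;> linarith

lemma integral_pow_le {μ : Measure ℝ} [IsProbabilityMeasure μ] {b r : ℝ}
    (h : μ (Set.Icc (-b) b) = 1) (hsymm : μ.map (fun x => -x) = μ) (hb : 0 ≤ b) (hr : 0 ≤ r)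
    {n : ℕ} (hn : Even n) :
    ∫ x, x ^ n ∂μ ≤ 2 * b ^ n * (μ (Set.Iic (-r))).toReal + r ^ n := by
  have hrefl : μ (Set.Ici r) = μ (Set.Iic (-r)) := by
    conv_rhs => rw [← hsymm, Measure.map_apply measurable_neg measurableSet_Iic]
    congr 1
    ext x
    simp
  have hi : ∀ s : Set ℝ, MeasurableSet s →
      Integrable (s.indicator fun _ => b ^ n) μ := fun s hs =>
    (integrable_const _).indicator hs
  have hI : ∀ s : Set ℝ, MeasurableSet s →
      ∫ x, s.indicator (fun _ => b ^ n) x ∂μ = (μ s).toReal * b ^ n := by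
    intro s hs
    rw [integral_indicator hs, integral_const]
    simp [Measure.real]
  have hle : ∫ x, x ^ n ∂μ ≤ ∫ x, ((Set.Iic (-r)).indicator (fun _ => b ^ n) x
      + (Set.Ici r).indicator (fun _ => b ^ n) x + r ^ n) ∂μ := by
    refine integral_mono_ae (integrable_of_Icc h (continuous_pow n))
      (((hi _ measurableSet_Iic).add (hi _ measurableSet_Ici)).add (integrable_const _)) ?_
    filter_upwards [ae_mem_of_Icc h] with x hx
    have hbn : x ^ n ≤ b ^ n := by
      rw [← hn.pow_abs]
      exact pow_le_pow_left₀ (abs_nonneg x) (abs_le.2 hx) n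
    have hnn : ∀ s : Set ℝ, 0 ≤ s.indicator (fun _ => b ^ n) x := fun s =>
      Set.indicator_nonneg (fun _ _ => by positivity) x
    have hrn : 0 ≤ r ^ n := by positivity
    have h1 := hnn (Set.Iic (-r))
    have h2 := hnn (Set.Ici r)
    by_cases hx1 : x ∈ Set.Iic (-r)
    · rw [Set.indicator_of_mem hx1]
      linarith
    by_cases hx2 : x ∈ Set.Ici r
    · rw [Set.indicator_of_mem hx2]
      linarith
    have : x ^ n ≤ r ^ n := by
      rw [← hn.pow_abs]
      refine pow_le_pow_left₀ (abs_nonneg x) (abs_le.2 ⟨?_, ?_⟩) n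
      · exact (not_le.1 hx1).le
      · exact (not_le.1 hx2).le
    linarith
  rw [integral_add (f := fun x => (Set.Iic (-r)).indicator (fun _ => b ^ n) x
      + (Set.Ici r).indicator (fun _ => b ^ n) x) (g := fun _ => r ^ n)
      ((hi _ measurableSet_Iic).add (hi _ measurableSet_Ici)) (integrable_const _),
    integral_add (hi _ measurableSet_Iic) (hi _ measurableSet_Ici), hI _ measurableSet_Iic,
    hI _ measurableSet_Ici, hrefl, integral_const] at hle
  simp only [Measure.real, measure_univ, ENNReal.toReal_one, one_smul] at hle
  linarith

lemma le_of_forall_pow_le {t F p : ℝ} (ht : 0 < t) (ht1 : t ≤ 1) (hF : 1 ≤ F)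
    (h : ∀ m : ℕ, (1 - t / 2) ^ (2 * m) / F ≤ 2 * p + (1 - t) ^ (2 * m)) :
    Real.exp (-2) / 16 / F ^ 3 ≤ p := by
  set m : ℕ := ⌈Real.log (2 * F) / t⌉₊
  have hlog : 0 ≤ Real.log (2 * F) := Real.log_nonneg (by linarith)
  have hm1 : Real.log (2 * F) ≤ t * m := by
    rw [← div_le_iff₀' ht]
    exact Nat.le_ceil _
  have hm2 : t * m ≤ Real.log (2 * F) + 1 := by
    have := (Nat.ceil_lt_add_one (div_nonneg hlog ht.le)).le
    calc t * m ≤ t * (Real.log (2 * F) / t + 1) := by gcongr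
      _ = Real.log (2 * F) + t := by field_simp
      _ ≤ _ := by linarith
  have hexp : Real.exp (-(t * m)) ≤ 1 / (2 * F) := by
    rw [Real.exp_neg, one_div]
    gcongr
    rw [← Real.log_le_iff_le_exp (by positivity)]
    exact hm1
  have hstep : (1 - t) ^ (2 * m) ≤ (1 - t / 2) ^ (2 * m) * (1 / (2 * F)) := by
    have h1 : 1 - t ≤ (1 - t / 2) * Real.exp (-(t / 2)) := by
      have := Real.one_sub_le_exp_neg (t / 2)
      nlinarith
    calc (1 - t) ^ (2 * m) ≤ ((1 - t / 2) * Real.exp (-(t / 2))) ^ (2 * m) :=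
          pow_le_pow_left₀ (by linarith) h1 _
      _ = (1 - t / 2) ^ (2 * m) * Real.exp (-(t * m)) := by
          rw [mul_pow, ← Real.exp_nat_mul]
          congr 2
          push_cast
          ring
      _ ≤ _ := by
          have : 0 ≤ 1 - t / 2 := by linarith
          gcongr
  have hlow : Real.exp (-2) / (2 * F) ^ 2 ≤ (1 - t / 2) ^ (2 * m) := by
    have h1 := exp_neg_two_mul_le (x := t / 2) (by positivity) (by linarith)
    refine le_trans ?_ (pow_le_pow_left₀ (Real.exp_pos _).le h1 _)
    rw [← Real.exp_nat_mul, ← Real.exp_log (show 0 < 2 * F by positivity), ← Real.exp_nat_mul,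
      ← Real.exp_sub]
    apply Real.exp_le_exp.2
    push_cast
    linarith
  have hm := h m
  have hsplit : (1 - t / 2) ^ (2 * m) / F
      = (1 - t / 2) ^ (2 * m) * (1 / (2 * F)) + (1 - t / 2) ^ (2 * m) * (1 / (2 * F)) := by
    field_simp
    ring
  have hfin : Real.exp (-2) / (2 * F) ^ 2 * (1 / (2 * F)) ≤ 2 * p :=
    (mul_le_mul_of_nonneg_right hlow (by positivity)).trans (by linarith)
  have : Real.exp (-2) / (2 * F) ^ 2 * (1 / (2 * F)) = 2 * (Real.exp (-2) / 16 / F ^ 3) := by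
    field_simp
    norm_num
  linarith

lemma lower_bound (hd : 2 ≤ d) : ∃ C > (0 : ℝ), ∃ c > (0 : ℝ),
    ∀ μ : Measure ℝ, IsProbabilityMeasure μ →
      μ (Set.Icc (-(2 * d : ℝ)) (2 * d)) = 1 →
      (∀ n : ℕ, ∫ x, x ^ n ∂μ = (T n d : ℝ)) →
      ∀ ε : ℝ, 0 < ε → ε ≤ 1 →
        c * Real.exp (-(C * ε ^ (-(d : ℝ) / 2) * Real.log (1 / ε + 2)))
          ≤ (μ (Set.Iic (-(2 * d : ℝ) + ε))).toReal := by
  have hd' : (2 : ℝ) ≤ d := by exact_mod_cast hd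
  set L : ℝ := Real.pi * √(2 * d) + 3 with hL
  have hL1 : 1 < L := by
    have : 0 ≤ Real.pi * √(2 * d) := by positivity
    linarith
  have hlogL : 0 < Real.log L := Real.log_pos hL1
  have hlog2 : 0 < Real.log 2 := Real.log_pos one_lt_two
  refine ⟨3 * (L ^ d * (d * (Real.log L / Real.log 2 + 1))), by positivity,
    Real.exp (-2) / 16, by positivity, ?_⟩
  intro μ _ hsupp hmom ε hε hε1
  rw [rpow_neg_half d hε]
  have hs : 0 < √ε := Real.sqrt_pos.2 hε
  set u : ℝ := (√ε)⁻¹ with hu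
  have hu1 : 1 ≤ u := (one_le_inv₀ hs).2 (Real.sqrt_le_one.2 hε1)
  have hu2 : u ^ 2 = 1 / ε := by
    rw [hu, inv_pow, Real.sq_sqrt hε.le, one_div]
  set t : ℝ := ε / (2 * d) with ht
  have ht0 : 0 < t := by positivity
  have ht1 : t ≤ 1 := by
    rw [ht, div_le_one (by positivity)]
    linarith
  have hrt : 2 * (d : ℝ) - ε = 2 * d * (1 - t) := by
    rw [ht]
    field_simp
  have hst : 0 < √t := Real.sqrt_pos.2 ht0
  set R : ℕ := ⌈Real.pi / (2 * √t)⌉₊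
  set N : ℕ := (2 * R + 1) ^ d with hN
  have hR : Real.pi / (2 * √t) ≤ R := Nat.le_ceil _
  have hθ : (Real.pi / (2 * (R + 1))) ^ 2 ≤ t := by
    rw [← Real.sq_sqrt ht0.le]
    refine pow_le_pow_left₀ (by positivity) ?_ 2
    rw [div_le_iff₀ (by positivity)] at hR ⊢
    nlinarith
  have hcos : 1 - t / 2 ≤ Real.cos (Real.pi / (2 * (R + 1))) := by
    linarith [Real.one_sub_sq_div_two_le_cos (x := Real.pi / (2 * (R + 1)))]
  have hsymm := map_neg_eq_self hsupp fun n hn => by rw [hmom, T_odd hn, Nat.cast_zero]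
  have key : Real.exp (-2) / 16 / (N.factorial : ℝ) ^ 3
      ≤ (μ (Set.Iic (-(2 * d : ℝ) + ε))).toReal := by
    refine le_of_forall_pow_le ht0 ht1 (by exact_mod_cast N.factorial_pos) fun m => ?_
    have h1 := integral_pow_le hsupp hsymm (by positivity)
      (show (0 : ℝ) ≤ 2 * d - ε by linarith) (even_two_mul m)
    rw [hmom, neg_sub, ← neg_add_eq_sub] at h1
    have h2 := (le_T_two_mul d R m).trans h1
    rw [hrt, mul_pow (2 * (d : ℝ)) (1 - t), mul_pow (2 * (d : ℝ)) (Real.cos _), mul_div_assoc,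
      ← hN] at h2
    have hpos : 0 < (2 * d : ℝ) ^ (2 * m) := by positivity
    refine le_of_mul_le_mul_left ?_ hpos
    have h3 : (1 - t / 2) ^ (2 * m) ≤ Real.cos (Real.pi / (2 * (R + 1))) ^ (2 * m) :=
      pow_le_pow_left₀ (by linarith) hcos _
    have h4 : (2 * d : ℝ) ^ (2 * m) * ((1 - t / 2) ^ (2 * m) / (N.factorial : ℝ)) ≤
        (2 * d : ℝ) ^ (2 * m) *
          (Real.cos (Real.pi / (2 * (R + 1))) ^ (2 * m) / (N.factorial : ℝ)) := by
      gcongr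
    linarith
  refine le_trans ?_ key
  rw [div_eq_mul_inv (Real.exp (-2) / 16)]
  refine mul_le_mul_of_nonneg_left ?_ (by positivity)
  have hN0 : (1 : ℝ) ≤ N := by exact_mod_cast Nat.one_le_pow _ _ (by omega)
  have hRu : 2 * (R : ℝ) + 1 ≤ L * u := by
    have h1 : (R : ℝ) ≤ Real.pi / (2 * √t) + 1 :=
      (Nat.ceil_lt_add_one (show 0 ≤ Real.pi / (2 * √t) by positivity)).le
    have h2 : Real.pi / (2 * √t) = Real.pi * √(2 * d) * u / 2 := by
      rw [ht, Real.sqrt_div hε.le, hu]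
      field_simp
    rw [h2] at h1
    rw [hL, add_mul]
    linarith
  have hNL : (N : ℝ) ≤ L ^ d * u ^ d := by
    rw [hN, ← mul_pow]
    push_cast
    gcongr
  have hℓ : Real.log 2 ≤ Real.log (1 / ε + 2) := by
    apply Real.log_le_log two_pos
    have : 0 < 1 / ε := by positivity
    linarith
  have hlogN : Real.log N ≤ d * (Real.log L / Real.log 2 + 1) * Real.log (1 / ε + 2) := by
    have h1 : Real.log N ≤ d * (Real.log L + Real.log u) := by
      rw [← Real.log_mul (by positivity) (by positivity), ← Real.log_pow, mul_pow]
      exact Real.log_le_log (by positivity) hNL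
    have h2 : Real.log u ≤ Real.log (1 / ε + 2) := by
      apply Real.log_le_log (by positivity)
      rw [← hu2]
      nlinarith
    have h3 : Real.log L ≤ Real.log L / Real.log 2 * Real.log (1 / ε + 2) := by
      rw [div_mul_eq_mul_div, le_div_iff₀ hlog2]
      gcongr
    refine h1.trans ?_
    rw [mul_assoc, add_mul, one_mul]
    gcongr
  have hfact : (N.factorial : ℝ) ≤ Real.exp (N * Real.log N) := by
    rw [Real.exp_nat_mul, Real.exp_log (by positivity)]
    exact_mod_cast N.factorial_le_pow
  rw [Real.exp_neg]
  refine inv_anti₀ (by positivity) ((pow_le_pow_left₀ (by positivity) hfact 3).trans ?_)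
  rw [← Real.exp_nat_mul]
  apply Real.exp_le_exp.2
  have hmul : N * Real.log N ≤ L ^ d * u ^ d *
      (d * (Real.log L / Real.log 2 + 1) * Real.log (1 / ε + 2)) :=
    mul_le_mul hNL hlogN (Real.log_nonneg hN0) (by positivity)
  push_cast
  linarith

end Umpteen

/-- **Theorem (Lifshitz tails for the integrated density of states of `H[ℤ^d]`).**
For every `d ≥ 2` there are `C, c > 0` such that for every probability measure `μ`
supported in `[−2d, 2d]` whose `n`-th moment is `T_n(d)` for all `n`, and every
`0 < ε ≤ 1`, one has
`c·exp(−C·ε^{−d/2}·log(1/ε + 2)) ≤ μ((−∞, −2d+ε]) ≤ C·exp(−c·ε^{−d/2})`. -/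
theorem umpteen_lifshitz_tails (d : ℕ) (hd : 2 ≤ d) :
    ∃ C > (0 : ℝ), ∃ c > (0 : ℝ),
      ∀ μ : Measure ℝ, IsProbabilityMeasure μ →
        μ (Set.Icc (-(2 * d : ℝ)) (2 * d)) = 1 →
        (∀ n : ℕ, ∫ x, x ^ n ∂μ = (T n d : ℝ)) →
        ∀ ε : ℝ, 0 < ε → ε ≤ 1 →
          c * Real.exp (-(C * ε ^ (-(d : ℝ) / 2) * Real.log (1 / ε + 2)))
              ≤ (μ (Set.Iic (-(2 * d : ℝ) + ε))).toReal ∧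
            (μ (Set.Iic (-(2 * d : ℝ) + ε))).toReal
              ≤ C * Real.exp (-(c * ε ^ (-(d : ℝ) / 2))) := by
  obtain ⟨C₁, hC₁, c₁, hc₁, h₁⟩ := Umpteen.lower_bound hd
  obtain ⟨C₂, hC₂, c₂, hc₂, h₂⟩ := Umpteen.upper_bound hd
  refine ⟨max C₁ C₂, lt_max_of_lt_left hC₁, min c₁ c₂, lt_min hc₁ hc₂, ?_⟩
  intro μ hμ hsupp hmom ε hε hε1
  have hlog : 0 ≤ Real.log (1 / ε + 2) := by
    apply Real.log_nonneg
    have : 0 < 1 / ε := by positivity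
    linarith
  constructor
  · refine le_trans ?_ (h₁ μ hμ hsupp hmom ε hε hε1)
    gcongr
    · exact min_le_left _ _
    · exact le_max_left _ _
  · refine (h₂ μ hμ hsupp hmom ε hε hε1).trans ?_
    gcongr
    · exact le_max_right _ _
    · exact min_le_right _ _
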